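/- Let 𝒢_h be a HEG with completed graph 𝒢̄ and underlying graph 𝒢 (obtained by forgetting the half-edges). If φ: 𝒢̄ → Σ ∪ ∂Σ is a regular embedding of 𝒢̄ in a punctured surface Σ with boundary ∂Σ, then the restriction of φ to 𝒢 is a cellular embedding of 𝒢 in the capped-off closed surface Σ̃, i.e. Σ̃ − φ(𝒢) is a disjoint union of 2-cells. -/

import Mathlib

/-! ## Surfaces, punctured surfaces and graph embeddings -/

noncomputable section
open scoped Classical

/-- The Euclidean plane. -/
abbrev Plane := EuclideanSpace ℝ (Fin 2)

/-- A subset of a topological space is a 2-cell if it is homeomorphic to an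
open disc. -/
def IsTwoCell {X : Type} [TopologicalSpace X] (A : Set X) : Prop :=
  Nonempty (A ≃ₜ (Metric.ball (0 : Plane) 1 : Set Plane))

/-- A subset is a 2-cell with punctures if it is homeomorphic to an open disc
with finitely many pairwise disjoint closed discs removed. -/
def IsPuncturedTwoCell {X : Type} [TopologicalSpace X] (A : Set X) : Prop :=
  ∃ (m : ℕ) (c : Fin m → Plane) (r : Fin m → ℝ),
    (∀ i, 0 < r i) ∧
    (∀ i, Metric.closedBall (c i) (r i) ⊆ Metric.ball (0 : Plane) 1) ∧
    (∀ i j, i ≠ j →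
      Disjoint (Metric.closedBall (c i) (r i)) (Metric.closedBall (c j) (r j))) ∧
    Nonempty (A ≃ₜ
      ((Metric.ball (0 : Plane) 1 \ ⋃ i, Metric.closedBall (c i) (r i)) : Set Plane))

/-- A closed surface: a compact connected Hausdorff space in which every point
has an open neighbourhood homeomorphic to an open disc. -/
def IsClosedSurface (X : Type) [TopologicalSpace X] : Prop :=
  CompactSpace X ∧ ConnectedSpace X ∧ T2Space X ∧
    ∀ x : X, ∃ U : Set X, IsOpen U ∧ x ∈ U ∧ IsTwoCell U

/-- A punctured surface: a closed connected compact surface `Total = Σ̃`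
together with finitely many pairwise disjoint embedded closed discs (the
punctures).  The punctured surface `Σ` itself is `Total` minus the closed
discs, `Σ ∪ ∂Σ` is `Total` minus the open discs, and `∂Σ` is the union of the
boundary circles of the discs; capping off the punctures gives back `Σ̃`. -/
structure PuncturedSurface where
  Total : Type
  [topo : TopologicalSpace Total]
  surf : IsClosedSurface Total
  n : ℕ
  cap : Fin n → (Metric.closedBall (0 : Plane) 1 : Set Plane) → Total
  capCont : ∀ i, Continuous (cap i)
  capInj : ∀ i, Function.Injective (cap i)
  capDisjoint : ∀ i j, i ≠ j → Disjoint (Set.range (cap i)) (Set.range (cap j))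

attribute [instance] PuncturedSurface.topo

namespace PuncturedSurface

variable (S : PuncturedSurface)

/-- The `i`-th removed closed disc. -/
def disc (i : Fin S.n) : Set S.Total := Set.range (S.cap i)

/-- The interior of the `i`-th removed disc. -/
def intDisc (i : Fin S.n) : Set S.Total := S.cap i '' {x | ‖(x : Plane)‖ < 1}

/-- The `i`-th boundary circle. -/
def bdCircle (i : Fin S.n) : Set S.Total := S.cap i '' {x | ‖(x : Plane)‖ = 1}

/-- The open punctured surface `Σ`. -/
def openPart : Set S.Total := Set.univ \ ⋃ i, S.disc i

/-- The surface with boundary `Σ ∪ ∂Σ`. -/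
def withBoundary : Set S.Total := Set.univ \ ⋃ i, S.intDisc i

/-- The boundary `∂Σ`. -/
def boundary : Set S.Total := ⋃ i, S.bdCircle i

/-- The union of the removed discs (the punctures). -/
def discs : Set S.Total := ⋃ i, S.disc i

end PuncturedSurface

/-- A finite multigraph: `ends e b` are the two end vertices of the edge `e`
(loops and parallel edges allowed). -/
structure Multigraph where
  V : Type
  E : Type
  vFin : Finite V
  eFin : Finite E
  ends : E → Bool → V

namespace Multigraph

variable (M : Multigraph)

/-- The disjoint union of the vertices and of one closed interval per edge. -/
def Pre : Type := M.V ⊕ (M.E × unitInterval)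

instance : TopologicalSpace M.Pre :=
  letI : TopologicalSpace M.V := ⊥
  letI : TopologicalSpace M.E := ⊥
  inferInstanceAs (TopologicalSpace (M.V ⊕ (M.E × unitInterval)))

/-- The gluing relation defining the topological realization: the two end
points of the interval of an edge are identified with its end vertices. -/
def glue : M.Pre → M.Pre → Prop := fun x y =>
  ∃ e b, x = Sum.inr (e, if b then 1 else 0) ∧ y = Sum.inl (M.ends e b)

/-- The topological realization `|M|` of the multigraph. -/
def Real : Type := Quot M.glue

instance : TopologicalSpace M.Real := inferInstanceAs (TopologicalSpace (Quot M.glue))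

/-- The point of `|M|` corresponding to a vertex. -/
def vtx (v : M.V) : M.Real := Quot.mk _ (Sum.inl v)

/-- The path in `|M|` corresponding to an edge. -/
def edgePath (e : M.E) (t : unitInterval) : M.Real := Quot.mk _ (Sum.inr (e, t))

end Multigraph

/-- A half-edge graph (HEG): a finite multigraph together with a finite set
`Hh` of half-edges, each incident to a unique vertex. -/
structure HEG where
  V : Type
  E : Type
  Hh : Type
  vFin : Finite V
  eFin : Finite E
  hFin : Finite Hh
  ends : E → Bool → V
  hInc : Hh → V

namespace HEG

variable (G : HEG)

/-- The underlying multigraph `𝒢` of a HEG (forget the half-edges). -/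
def underlyingMG : Multigraph where
  V := G.V
  E := G.E
  vFin := G.vFin
  eFin := G.eFin
  ends := G.ends

/-- The completed graph `𝒢̄(𝒱 ∪ 𝒱_h, ℰ ∪ h)` of a HEG: one new vertex is
added for each half-edge, and each half-edge `h` incident to `v₀` becomes an
edge joining `v₀` to its new vertex. -/
def completedMG : Multigraph where
  V := G.V ⊕ G.Hh
  E := G.E ⊕ G.Hh
  vFin := by haveI := G.vFin; haveI := G.hFin; exact inferInstance
  eFin := by haveI := G.eFin; haveI := G.hFin; exact inferInstance
  ends := fun e b => match e with
    | .inl e => .inl (G.ends e b)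
    | .inr h => if b then .inr h else .inl (G.hInc h)

/-- The natural inclusion `|𝒢| → |𝒢̄|` of the realization of the underlying
graph into the realization of the completed graph. -/
def inclReal : G.underlyingMG.Real → G.completedMG.Real :=
  Quot.map (Sum.map Sum.inl (fun p => (Sum.inl p.1, p.2))) (by
    rintro x y ⟨e, b, rfl, rfl⟩
    exact ⟨Sum.inl e, b, rfl, rfl⟩)

end HEG

/-- An embedding of a multigraph in a punctured surface whose image avoids the
open punctures and which decomposes the capped-off closed surface `Σ̃` into
2-cells. -/
structure CellEmbedding (M : Multigraph) (S : PuncturedSurface) where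
  toFun : M.Real → S.Total
  emb : Topology.IsEmbedding toFun
  range_subset : Set.range toFun ⊆ S.withBoundary
  cellular : ∀ x ∈ Set.univ \ Set.range toFun,
    IsTwoCell (connectedComponentIn (Set.univ \ Set.range toFun) x)

/-- A cell embedding is `W`-regular if the embedded graph meets the boundary
`∂Σ` exactly in the vertices of `W`. -/
def CellEmbedding.VRegular {M : Multigraph} {S : PuncturedSurface}
    (φ : CellEmbedding M S) (W : Set M.V) : Prop :=
  S.boundary ∩ Set.range φ.toFun = φ.toFun '' (M.vtx '' W)

/-- A regular embedding of (the completed graph of) a HEG `G` in `Σ ∪ ∂Σ`: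
a `𝒱_h`-regular cell embedding of `𝒢̄`.  This is the datum of a HEG cellular
embedding `G ⊂ Σ`. -/
structure RegularEmbedding (G : HEG) (S : PuncturedSurface) extends
    CellEmbedding G.completedMG S where
  regular : toCellEmbedding.VRegular (Set.range (Sum.inr : G.Hh → G.V ⊕ G.Hh))

section CellRemoval

open Topology Filter

/-- A self-homeomorphism is supported in `Ω` if it is the identity outside some compact
subset of `Ω`. -/
def SuppIn {X : Type*} [TopologicalSpace X] (h : X ≃ₜ X) (Ω : Set X) : Prop :=
  ∃ C, IsCompact C ∧ C ⊆ Ω ∧ ∀ x, x ∉ C → h x = x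

namespace SuppIn

variable {X Y : Type*} [TopologicalSpace X] [TopologicalSpace Y] {Ω Ω' : Set X} {h k : X ≃ₜ X}

theorem refl (Ω : Set X) : SuppIn (Homeomorph.refl X) Ω :=
  ⟨∅, isCompact_empty, Set.empty_subset _, fun _ _ => rfl⟩

theorem mono (hh : SuppIn h Ω) (hs : Ω ⊆ Ω') : SuppIn h Ω' := by
  obtain ⟨C, hC, hCΩ, hid⟩ := hh
  exact ⟨C, hC, hCΩ.trans hs, hid⟩

theorem symm (hh : SuppIn h Ω) : SuppIn h.symm Ω := by
  obtain ⟨C, hC, hCΩ, hid⟩ := hh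
  exact ⟨C, hC, hCΩ, fun x hx => by rw [Homeomorph.symm_apply_eq, hid x hx]⟩

theorem trans (hh : SuppIn h Ω) (hk : SuppIn k Ω) : SuppIn (h.trans k) Ω := by
  obtain ⟨C, hC, hCΩ, hid⟩ := hh
  obtain ⟨D, hD, hDΩ, hid'⟩ := hk
  refine ⟨C ∪ D, hC.union hD, Set.union_subset hCΩ hDΩ, fun x hx => ?_⟩
  rw [Set.mem_union, not_or] at hx
  simp [hid x hx.1, hid' x hx.2]

theorem apply_eq (hh : SuppIn h Ω) {x : X} (hx : x ∉ Ω) : h x = x := by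
  obtain ⟨C, hC, hCΩ, hid⟩ := hh
  exact hid x fun hxC => hx (hCΩ hxC)

theorem mem (hh : SuppIn h Ω) {x : X} (hx : x ∈ Ω) : h x ∈ Ω := by
  by_contra hc
  have := hh.apply_eq hc
  exact hc (by rwa [h.injective this])

/-- A compactly supported homeomorphism of an open piece of a Hausdorff space extends by the
identity. -/
theorem extend [T2Space X] {ψ : Y → X} (hψ : Topology.IsOpenEmbedding ψ) {g : Y ≃ₜ Y} {U : Set Y}
    (hg : SuppIn g U) : ∃ G : X ≃ₜ X, SuppIn G (ψ '' U) ∧ ∀ y, G (ψ y) = ψ (g y) := by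
  have key : ∀ g : Y ≃ₜ Y, SuppIn g U →
      ∃ F : X → X, Continuous F ∧ (∀ y, F (ψ y) = ψ (g y)) ∧ ∀ x, x ∉ Set.range ψ → F x = x := by
    rintro g ⟨C, hC, hCU, hid⟩
    let F : X → X := fun x => if hx : x ∈ Set.range ψ then ψ (g hx.choose) else x
    have hF1 : ∀ y, F (ψ y) = ψ (g y) := by
      intro y
      have hy : ψ y ∈ Set.range ψ := ⟨y, rfl⟩
      simp only [F, dif_pos hy]
      rw [hψ.injective hy.choose_spec]
    have hF2 : ∀ x, x ∉ Set.range ψ → F x = x := fun x hx => by simp only [F, dif_neg hx]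
    refine ⟨F, ?_, hF1, hF2⟩
    rw [continuous_iff_continuousAt]
    intro x
    by_cases hx : x ∈ Set.range ψ
    · obtain ⟨y, rfl⟩ := hx
      rw [← hψ.continuousAt_iff]
      have : F ∘ ψ = ψ ∘ g := funext hF1
      rw [this]
      exact (hψ.continuous.comp g.continuous).continuousAt
    · have hcl : IsClosed (ψ '' C) := (hC.image hψ.continuous).isClosed
      have hxC : x ∈ (ψ '' C)ᶜ := fun ⟨y, _, hy⟩ => hx ⟨y, hy⟩
      refine continuousAt_id.congr ?_
      filter_upwards [hcl.isOpen_compl.mem_nhds hxC] with z hz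
      by_cases hzr : z ∈ Set.range ψ
      · obtain ⟨y, rfl⟩ := hzr
        rw [hF1, hid y fun hy => hz ⟨y, hy, rfl⟩]; rfl
      · rw [hF2 z hzr]; rfl
  obtain ⟨F, hFc, hF1, hF2⟩ := key g hg
  obtain ⟨F', hFc', hF1', hF2'⟩ := key g.symm hg.symm
  refine ⟨⟨⟨F, F', fun x => ?_, fun x => ?_⟩, hFc, hFc'⟩, ?_, hF1⟩
  · by_cases hx : x ∈ Set.range ψ
    · obtain ⟨y, rfl⟩ := hx
      rw [hF1, hF1', Homeomorph.symm_apply_apply]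
    · rw [hF2 x hx, hF2' x hx]
  · by_cases hx : x ∈ Set.range ψ
    · obtain ⟨y, rfl⟩ := hx
      rw [hF1', hF1, Homeomorph.apply_symm_apply]
    · rw [hF2' x hx, hF2 x hx]
  · obtain ⟨C, hC, hCU, hid⟩ := hg
    refine ⟨ψ '' C, hC.image hψ.continuous, Set.image_mono hCU, fun x hx => ?_⟩
    change F x = x
    by_cases hxr : x ∈ Set.range ψ
    · obtain ⟨y, rfl⟩ := hxr
      rw [hF1, hid y fun hy => hx ⟨y, hy, rfl⟩]
    · exact hF2 x hxr

end SuppIn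

/-- Radial expansion of the plane: fixed on a small ball, compactly supported, and carrying an
intermediate ball onto an arbitrarily large one. -/
theorem exists_radial_expansion {a b R : ℝ} (ha : 0 < a) (hab : a < b) (hbR : b < R) :
    ∃ g : ℂ ≃ₜ ℂ, SuppIn g (Metric.ball (0 : ℂ) (3 * R)) ∧
      (∀ z, ‖z‖ ≤ a → g z = z) ∧ ∀ z, ‖z‖ ≤ R → ‖g.symm z‖ ≤ b := by
  set κ : ℝ := 1 + (R - a) / (b - a) with hκ
  have hq : 0 < (R - a) / (b - a) := div_pos (by linarith) (by linarith)
  let ρ : ℝ → ℝ := fun s => max s (min (a + κ * (s - a)) (R + s / 2))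
  have hρc : Continuous ρ := by fun_prop
  have hρm : StrictMono ρ := by
    intro s t hst
    have h1 : a + κ * (s - a) < a + κ * (t - a) := by
      have : κ * (s - a) < κ * (t - a) := mul_lt_mul_of_pos_left (by linarith) (by linarith)
      linarith
    exact max_lt_max hst (min_lt_min h1 (by linarith))
  have hlow : ∀ s, s ≤ a → ρ s = s := by
    intro s hs
    refine max_eq_left ((min_le_left _ _).trans ?_)
    rw [hκ]
    nlinarith [mul_nonneg hq.le (sub_nonneg.2 hs)]
  have hhigh : ∀ s, 2 * R ≤ s → ρ s = s := by
    intro s hs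
    exact max_eq_left ((min_le_right _ _).trans (by linarith))
  have hb : R ≤ ρ b := by
    refine le_max_of_le_right (le_min ?_ (by linarith))
    rw [hκ, add_mul, div_mul_cancel₀ _ (by linarith)]
    linarith
  have hsurj : Function.Surjective ρ := by
    refine hρc.surjective ?_ ?_
    · exact Filter.tendsto_atTop_mono (fun s => le_max_left _ _) Filter.tendsto_id
    · refine Filter.tendsto_id.congr' ?_
      filter_upwards [Filter.eventually_le_atBot a] with s hs using (hlow s hs).symm
  let e : ℝ ≃o ℝ := StrictMono.orderIsoOfSurjective ρ hρm hsurj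
  have he : ∀ s, e s = ρ s := fun s => rfl
  have key : ∀ σ : ℝ ≃o ℝ, (∀ s, s ≤ a → σ s = s) →
      Continuous (fun z : ℂ => ((σ ‖z‖ / ‖z‖ : ℝ) : ℂ) * z) ∧
      (∀ z : ℂ, ‖((σ ‖z‖ / ‖z‖ : ℝ) : ℂ) * z‖ = σ ‖z‖) ∧
      (∀ z : ℂ, ‖z‖ ≤ a → ((σ ‖z‖ / ‖z‖ : ℝ) : ℂ) * z = z) := by
    intro σ hσ
    have h3 : ∀ z : ℂ, ‖z‖ ≤ a → ((σ ‖z‖ / ‖z‖ : ℝ) : ℂ) * z = z := by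
      intro z hz
      by_cases h0 : z = 0
      · simp [h0]
      · rw [hσ _ hz, div_self (norm_ne_zero_iff.2 h0)]; simp
    refine ⟨?_, ?_, h3⟩
    · rw [continuous_iff_continuousAt]
      intro z
      by_cases h0 : z = 0
      · refine continuousAt_id.congr ?_
        have : ∀ᶠ w in nhds z, ‖w‖ < a := by
          refine (continuous_norm.tendsto z).eventually_lt_const ?_
          simpa [h0] using ha
        filter_upwards [this] with w hw using (h3 w hw.le).symm
      · have hz : ‖z‖ ≠ 0 := norm_ne_zero_iff.2 h0
        have hσc : Continuous σ := σ.continuous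
        refine ContinuousAt.mul (Complex.continuous_ofReal.continuousAt.comp ?_) continuousAt_id
        exact ((hσc.comp continuous_norm).continuousAt).div continuous_norm.continuousAt hz
    · intro z
      by_cases h0 : z = 0
      · simp [h0, hσ 0 ha.le]
      · have hz : 0 < ‖z‖ := norm_pos_iff.2 h0
        have hσ0 : 0 ≤ σ ‖z‖ := by
          have := σ.monotone hz.le
          rwa [hσ 0 ha.le] at this
        rw [norm_mul, Complex.norm_real, Real.norm_of_nonneg (div_nonneg hσ0 hz.le),
          div_mul_cancel₀ _ hz.ne']
  have hlow' : ∀ s, s ≤ a → e.symm s = s := by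
    intro s hs
    rw [OrderIso.symm_apply_eq, he, hlow s hs]
  obtain ⟨c1, n1, i1⟩ := key e hlow
  obtain ⟨c2, n2, i2⟩ := key e.symm hlow'
  have inv : ∀ σ : ℝ ≃o ℝ, (∀ z : ℂ, ‖((σ ‖z‖ / ‖z‖ : ℝ) : ℂ) * z‖ = σ ‖z‖) → σ 0 = 0 → ∀ z : ℂ,
      ((σ.symm ‖((σ ‖z‖ / ‖z‖ : ℝ) : ℂ) * z‖ / ‖((σ ‖z‖ / ‖z‖ : ℝ) : ℂ) * z‖ : ℝ) : ℂ) *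
        (((σ ‖z‖ / ‖z‖ : ℝ) : ℂ) * z) = z := by
    intro σ hn h00 z
    rw [hn z, OrderIso.symm_apply_apply]
    by_cases h0 : z = 0
    · simp [h0]
    · have hz : 0 < ‖z‖ := norm_pos_iff.2 h0
      have hσ0 : 0 < σ ‖z‖ := by
        have := σ.strictMono hz
        rwa [h00] at this
      rw [← mul_assoc, ← Complex.ofReal_mul, div_mul_div_cancel₀ hσ0.ne', div_self hz.ne']
      simp
  let g : ℂ ≃ₜ ℂ :=
    { toFun := fun z => ((e ‖z‖ / ‖z‖ : ℝ) : ℂ) * z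
      invFun := fun z => ((e.symm ‖z‖ / ‖z‖ : ℝ) : ℂ) * z
      left_inv := inv e n1 (hlow 0 ha.le)
      right_inv := inv e.symm n2 (hlow' 0 ha.le)
      continuous_toFun := c1
      continuous_invFun := c2 }
  refine ⟨g, ⟨Metric.closedBall 0 (2 * R), isCompact_closedBall _ _,
    Metric.closedBall_subset_ball (by linarith), fun z hz => ?_⟩, i1, fun z hz => ?_⟩
  · have hz' : 2 * R < ‖z‖ := by simpa using hz
    change ((e ‖z‖ / ‖z‖ : ℝ) : ℂ) * z = z
    rw [he, hhigh _ hz'.le, div_self (by linarith)]; simp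
  · change ‖((e.symm ‖z‖ / ‖z‖ : ℝ) : ℂ) * z‖ ≤ b
    rw [n2, ← e.le_iff_le, OrderIso.apply_symm_apply]
    exact hz.trans hb

theorem exists_cell_enlargement {U : Type*} [TopologicalSpace U] [T2Space U]
    (hcov : ∀ K : Set U, IsCompact K → ∃ χ : ℂ → U, IsOpenEmbedding χ ∧ K ⊆ Set.range χ)
    {φ : ℂ → U} (hφ : IsOpenEmbedding φ) {K : Set U} (hK : IsCompact K) {n : ℝ} (hn : 1 ≤ n) :
    ∃ φ' : ℂ → U, IsOpenEmbedding φ' ∧ (∀ z, ‖z‖ ≤ n → φ' z = φ z) ∧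
      K ⊆ φ' '' Metric.closedBall 0 (3 * n) := by
  obtain ⟨χ₀, hχ₀, hsub⟩ := hcov (K ∪ φ '' Metric.closedBall 0 (3 * n))
    (hK.union ((isCompact_closedBall _ _).image hφ.continuous))
  obtain ⟨c, hc⟩ : φ 0 ∈ Set.range χ₀ :=
    hsub (Or.inr ⟨0, Metric.mem_closedBall_self (by linarith), rfl⟩)
  obtain ⟨χ, hχ, h0, hrange⟩ : ∃ χ : ℂ → U, IsOpenEmbedding χ ∧ χ 0 = φ 0 ∧
      Set.range χ = Set.range χ₀ := by
    refine ⟨χ₀ ∘ Homeomorph.addRight c, hχ₀.comp (Homeomorph.addRight c).isOpenEmbedding, ?_, ?_⟩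
    · simp [hc]
    · exact (Homeomorph.addRight c).surjective.range_comp _
  rw [← hrange] at hsub
  have small : ∀ {f g : ℂ → U}, IsOpenEmbedding f → IsOpenEmbedding g → f 0 = g 0 →
      ∀ r > 0, ∃ b > 0, b < 1 ∧ f '' Metric.closedBall 0 b ⊆ g '' Metric.ball 0 r := by
    intro f g hf hg hfg r hr
    have ho : IsOpen (g '' Metric.ball 0 r) := hg.isOpenMap _ Metric.isOpen_ball
    have hm : f ⁻¹' (g '' Metric.ball 0 r) ∈ 𝓝 (0 : ℂ) :=
      (ho.preimage hf.continuous).mem_nhds ⟨0, by simpa using hr, hfg.symm⟩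
    obtain ⟨b, hb, hb'⟩ := Metric.nhds_basis_closedBall.mem_iff.1 hm
    refine ⟨min b (1 / 2), by positivity, (min_le_right _ _).trans_lt (by norm_num), ?_⟩
    rw [Set.image_subset_iff]
    exact (Metric.closedBall_subset_closedBall (min_le_left _ _)).trans hb'
  obtain ⟨b, hb, -, hbφ⟩ := small hχ hφ h0 1 one_pos
  obtain ⟨b₁, hb₁, hb₁1, hb₁χ⟩ := small hφ hχ h0.symm (b / 2) (by linarith)
  obtain ⟨g₁, hg₁, -, hg₁R⟩ := exists_radial_expansion (a := b₁ / 2) (b := b₁) (R := n)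
    (by linarith) (by linarith) (by linarith)
  obtain ⟨f, hf, hfφ⟩ := hg₁.symm.extend hφ
  have hfχ : ∀ x ∈ Set.range χ, f x ∈ Set.range χ := fun x hx => by
    by_cases hx' : x ∈ φ '' Metric.ball 0 (3 * n)
    · exact hsub (Or.inr (Set.image_mono Metric.ball_subset_closedBall (hf.mem hx')))
    · rwa [hf.apply_eq hx']
  have hcomp : IsCompact (χ ⁻¹' (f '' K)) :=
    hχ.isInducing.isCompact_preimage' (hK.image f.continuous) (by
      rintro _ ⟨x, hx, rfl⟩
      exact hfχ x (hsub (Or.inl hx)))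
  obtain ⟨R₀, hR₀⟩ := hcomp.isBounded.subset_closedBall (0 : ℂ)
  obtain ⟨g₂, hg₂, hg₂a, hg₂R⟩ := exists_radial_expansion (a := b / 2) (b := b)
    (R := max R₀ (b + 1)) (by linarith) (by linarith) (by simp)
  obtain ⟨g, -, hgχ⟩ := hg₂.extend hχ
  refine ⟨fun z => f.symm (g (f (φ z))), ?_, ?_, ?_⟩
  · exact f.symm.isOpenEmbedding.comp (g.isOpenEmbedding.comp (f.isOpenEmbedding.comp hφ))
  · intro z hz
    obtain ⟨w, hw, hwe⟩ := hb₁χ ⟨g₁.symm z, by simpa using hg₁R z hz, rfl⟩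
    have hw' : ‖w‖ ≤ b / 2 := by simpa using (Metric.mem_ball.1 hw).le
    rw [Homeomorph.symm_apply_eq, hfφ, ← hwe, hgχ, hg₂a w hw']
  · intro x hx
    obtain ⟨w, hw⟩ := hfχ x (hsub (Or.inl hx))
    have hwR : ‖w‖ ≤ max R₀ (b + 1) := by
      have : w ∈ χ ⁻¹' (f '' K) := ⟨x, hx, hw.symm⟩
      exact (by simpa using hR₀ this : ‖w‖ ≤ R₀).trans (le_max_left _ _)
    obtain ⟨u, hu, hue⟩ := hbφ ⟨g₂.symm w, by simpa using hg₂R w hwR, rfl⟩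
    refine ⟨g₁ u, Metric.ball_subset_closedBall (hg₁.mem ?_), ?_⟩
    · exact Metric.ball_subset_ball (by linarith) hu
    · change f.symm (g (f (φ (g₁ u)))) = x
      rw [Homeomorph.symm_apply_eq, hfφ, Homeomorph.symm_apply_apply, hue, hgχ,
        Homeomorph.apply_symm_apply, hw]

/-- Brown's theorem: a space in which every compact set lies in an open cell, and which is
exhausted by compact sets, is an open cell. -/
theorem nonempty_homeomorph_complex {U : Type*} [TopologicalSpace U] [T2Space U]
    (K : CompactExhaustion U)
    (hcov : ∀ K : Set U, IsCompact K → ∃ χ : ℂ → U, IsOpenEmbedding χ ∧ K ⊆ Set.range χ) :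
    Nonempty (ℂ ≃ₜ U) := by
  let P := {φ : ℂ → U // IsOpenEmbedding φ}
  have hstep : ∀ (i : ℕ) (φ : P), ∃ φ' : P, (∀ z, ‖z‖ ≤ 3 ^ i → φ'.1 z = φ.1 z) ∧
      K i ⊆ φ'.1 '' Metric.closedBall 0 (3 ^ (i + 1)) := by
    intro i φ
    obtain ⟨φ', h1, h2, h3⟩ := exists_cell_enlargement hcov φ.2 (K.isCompact i)
      (one_le_pow₀ (by norm_num : (1 : ℝ) ≤ 3) (n := i))
    exact ⟨⟨φ', h1⟩, h2, by rwa [pow_succ']⟩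
  choose next hnext1 hnext2 using hstep
  obtain ⟨φ₀, hφ₀, -⟩ := hcov ∅ isCompact_empty
  let φ : ℕ → P := fun n => Nat.rec ⟨φ₀, hφ₀⟩ (fun i p => next i p) n
  have hφs : ∀ i, φ (i + 1) = next i (φ i) := fun i => rfl
  have hagree : ∀ i j, i ≤ j → ∀ z, ‖z‖ ≤ 3 ^ i → (φ j).1 z = (φ i).1 z := by
    intro i j hij
    induction j, hij using Nat.le_induction with
    | base => intro z _; rfl
    | succ j hij ih =>
      intro z hz
      rw [hφs, hnext1, ih z hz]
      exact hz.trans (pow_le_pow_right₀ (by norm_num) hij)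
  have hlt : ∀ z : ℂ, ‖z‖ < 3 ^ ⌈‖z‖⌉₊ := fun z =>
    (Nat.le_ceil _).trans_lt (by exact_mod_cast Nat.lt_pow_self (by norm_num))
  let Φ : ℂ → U := fun z => (φ ⌈‖z‖⌉₊).1 z
  have hΦ : ∀ i z, ‖z‖ ≤ 3 ^ i → Φ z = (φ i).1 z := by
    intro i z hz
    rcases le_total i ⌈‖z‖⌉₊ with h | h
    · exact hagree _ _ h z hz
    · exact (hagree _ _ h z (hlt z).le).symm
  have hev : ∀ z, Φ =ᶠ[𝓝 z] (φ ⌈‖z‖⌉₊).1 := by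
    intro z
    filter_upwards [(continuous_norm.tendsto z).eventually_lt_const (hlt z)] with w hw
    exact hΦ _ w hw.le
  have hcont : Continuous Φ := continuous_iff_continuousAt.2 fun z =>
    ((φ ⌈‖z‖⌉₊).2.continuous.continuousAt).congr (hev z).symm
  have hopen : IsOpenMap Φ := IsOpenMap.of_nhds_le fun z => by
    rw [Filter.map_congr (hev z)]
    exact (φ ⌈‖z‖⌉₊).2.isOpenMap.nhds_le z
  have hinj : Function.Injective Φ := by
    intro z w hzw
    have hz : ‖z‖ ≤ 3 ^ max ⌈‖z‖⌉₊ ⌈‖w‖⌉₊ :=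
      (hlt z).le.trans (pow_le_pow_right₀ (by norm_num) (le_max_left _ _))
    have hw : ‖w‖ ≤ 3 ^ max ⌈‖z‖⌉₊ ⌈‖w‖⌉₊ :=
      (hlt w).le.trans (pow_le_pow_right₀ (by norm_num) (le_max_right _ _))
    rw [hΦ _ z hz, hΦ _ w hw] at hzw
    exact (φ _).2.injective hzw
  have hsurj : Function.Surjective Φ := by
    intro x
    obtain ⟨i, hi⟩ := Set.mem_iUnion.1 (K.iUnion_eq ▸ Set.mem_univ x : x ∈ ⋃ i, K i)
    obtain ⟨z, hz, hzx⟩ := hnext2 i (φ i) hi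
    refine ⟨z, ?_⟩
    rw [hΦ (i + 1) z (by simpa using hz), hφs, hzx]
  exact ⟨(Equiv.ofBijective Φ ⟨hinj, hsurj⟩).toHomeomorphOfContinuousOpen hcont hopen⟩

/-- A compactly supported homeomorphism of `ℝ²` moving points to the left and carrying a given
compact set into the left half-plane. -/
theorem exists_push_left {C : Set (ℝ × ℝ)} (hC : IsCompact C) :
    ∃ p : (ℝ × ℝ) ≃ₜ (ℝ × ℝ), SuppIn p Set.univ ∧ (∀ z, (p z).1 ≤ z.1) ∧
      (∀ z, (p z).2 = z.2) ∧ ∀ z ∈ C, (p z).1 < 0 := by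
  obtain ⟨M₀, hM₀⟩ := hC.isBounded.subset_closedBall (0 : ℝ × ℝ)
  set M := max M₀ 0 with hM
  have hMnn : 0 ≤ M := le_max_right _ _
  let w : ℝ × ℝ → ℝ := fun z => max 0 (min (M + 1) ((4 * (M + 1) + 2 * M - |z.1| - |z.2|) / 4))
  have hw0 : ∀ z, 0 ≤ w z := fun z => le_max_left _ _
  have hwl : ∀ z z', |w z - w z'| ≤ 1 / 2 * ‖z - z'‖ := by
    intro z z'
    have h1 : |w z - w z'| ≤ |(4 * (M + 1) + 2 * M - |z.1| - |z.2|) / 4 -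
        (4 * (M + 1) + 2 * M - |z'.1| - |z'.2|) / 4| := by
      refine (abs_max_sub_max_le_max _ _ _ _).trans (max_le (by simp) ?_)
      exact (abs_min_sub_min_le_max _ _ _ _).trans (max_le (by simp) le_rfl)
    have h2 : |z.1 - z'.1| ≤ ‖z - z'‖ := norm_fst_le (z - z')
    have h3 : |z.2 - z'.2| ≤ ‖z - z'‖ := norm_snd_le (z - z')
    have h4 := abs_abs_sub_abs_le_abs_sub z.1 z'.1
    have h5 := abs_abs_sub_abs_le_abs_sub z.2 z'.2
    refine h1.trans ?_
    rw [abs_le] at h4 h5 ⊢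
    constructor <;> linarith
  have happ : ApproximatesLinearOn (fun z : ℝ × ℝ => (z.1 - w z, z.2))
      ((ContinuousLinearEquiv.refl ℝ (ℝ × ℝ) : (ℝ × ℝ) ≃L[ℝ] (ℝ × ℝ)) : (ℝ × ℝ) →L[ℝ] (ℝ × ℝ))
      Set.univ (1 / 2) := by
    intro z _ z' _
    have : (z.1 - w z, z.2) - (z'.1 - w z', z'.2) -
        ((ContinuousLinearEquiv.refl ℝ (ℝ × ℝ) : (ℝ × ℝ) ≃L[ℝ] (ℝ × ℝ)) : (ℝ × ℝ) →L[ℝ] (ℝ × ℝ))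
          (z - z') = (-(w z - w z'), 0) := by
      ext <;> simp <;> ring
    simp only [this]
    rw [Prod.norm_def]
    refine max_le ?_ ?_
    · rw [norm_neg, Real.norm_eq_abs]
      refine (hwl z z').trans_eq ?_
      simp
    · rw [norm_zero]; positivity
  have hN : (1 / 2 : NNReal) <
      ‖(((ContinuousLinearEquiv.refl ℝ (ℝ × ℝ)).symm : (ℝ × ℝ) ≃L[ℝ] (ℝ × ℝ)) :
        (ℝ × ℝ) →L[ℝ] (ℝ × ℝ))‖₊⁻¹ := by
    have : ‖(((ContinuousLinearEquiv.refl ℝ (ℝ × ℝ)).symm : (ℝ × ℝ) ≃L[ℝ] (ℝ × ℝ)) :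
        (ℝ × ℝ) →L[ℝ] (ℝ × ℝ))‖₊ = 1 := by
      change ‖ContinuousLinearMap.id ℝ (ℝ × ℝ)‖₊ = 1
      simp
    rw [this, inv_one]
    exact NNReal.half_lt_self one_ne_zero
  let p := ApproximatesLinearOn.toHomeomorph _ happ (Or.inr hN)
  have hp : ∀ z, p z = (z.1 - w z, z.2) := fun z => rfl
  refine ⟨p, ⟨Metric.closedBall 0 (4 * (M + 1) + 2 * M), isCompact_closedBall _ _,
    Set.subset_univ _, fun z hz => ?_⟩, fun z => ?_,
    fun z => rfl, fun z hz => ?_⟩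
  · have hz' : 4 * (M + 1) + 2 * M < max |z.1| |z.2| := by
      have := mt mem_closedBall_zero_iff.2 hz
      rwa [not_le, Prod.norm_def] at this
    have : w z = 0 := by
      refine max_eq_left ((min_le_right _ _).trans ?_)
      have := max_le_add_of_nonneg (abs_nonneg z.1) (abs_nonneg z.2)
      linarith
    rw [hp, this, sub_zero]
  · rw [hp]; have := hw0 z; simp only; linarith
  · have hzM : max |z.1| |z.2| ≤ M := by
      have : ‖z‖ ≤ M₀ := by simpa using hM₀ hz
      rw [Prod.norm_def] at this
      exact this.trans (le_max_left _ _)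
    have h1 := (le_max_left _ _).trans hzM
    have h2 := (le_max_right _ _).trans hzM
    have : w z = M + 1 := by
      change max 0 (min (M + 1) _) = _
      rw [min_eq_left (by linarith), max_eq_right (by linarith)]
    rw [hp, this]
    have := le_abs_self z.1
    simp only; linarith

/-- Every compact subset of `E` can be pushed into `X₀` by a homeomorphism compactly supported in
`ω` that maps `X₀` into itself. -/
def Pushable (ω X₀ E : Set ℂ) : Prop :=
  ∀ L : Set ℂ, IsCompact L → L ⊆ E →
    ∃ h : ℂ ≃ₜ ℂ, SuppIn h ω ∧ Set.MapsTo h L X₀ ∧ Set.MapsTo h X₀ X₀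

theorem Pushable.attach {ω X₀ E : Set ℂ} (hP : Pushable ω X₀ E) (hE : IsOpen E)
    {ψ : ℝ × ℝ → ℂ} (hψ : IsOpenEmbedding ψ) (hω : Set.range ψ ⊆ ω)
    (hleft : ∀ p : ℝ × ℝ, p.1 < 0 → ψ p ∈ E)
    (hEψ : ∀ p p' : ℝ × ℝ, p'.2 = p.2 → p'.1 ≤ p.1 → ψ p ∈ E → ψ p' ∈ E)
    (hXψ : ∀ p p' : ℝ × ℝ, p'.2 = p.2 → p'.1 ≤ p.1 → ψ p ∈ X₀ → ψ p' ∈ X₀) :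
    Pushable ω X₀ (E ∪ Set.range ψ) := by
  intro L hL hLE
  have hLr : L \ E ⊆ Set.range ψ := fun z hz => (hLE hz.1).resolve_left hz.2
  have hC : IsCompact (ψ ⁻¹' (L \ E)) :=
    hψ.isInducing.isCompact_preimage' (hL.diff hE) hLr
  obtain ⟨p, hp, hple, hp2, hpC⟩ := exists_push_left hC
  obtain ⟨q, hq, hqψ⟩ := hp.extend hψ
  rw [Set.image_univ] at hq
  have hmaps : ∀ S : Set ℂ, (∀ p p' : ℝ × ℝ, p'.2 = p.2 → p'.1 ≤ p.1 → ψ p ∈ S → ψ p' ∈ S) →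
      Set.MapsTo q S S := by
    intro S hS z hz
    by_cases hzr : z ∈ Set.range ψ
    · obtain ⟨y, rfl⟩ := hzr
      rw [hqψ]
      exact hS _ _ (hp2 y) (hple y) hz
    · rwa [hq.apply_eq hzr]
  have hqE := hmaps E hEψ
  have hqX := hmaps X₀ hXψ
  obtain ⟨h, hh, hhL, hhX⟩ := hP (q '' L) (hL.image q.continuous) (by
    rintro _ ⟨z, hz, rfl⟩
    by_cases hzE : z ∈ E
    · exact hqE hzE
    · obtain ⟨y, rfl⟩ := hLr ⟨hz, hzE⟩
      rw [hqψ]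
      exact hleft _ (hpC y ⟨hz, hzE⟩))
  exact ⟨q.trans h, (hq.mono hω).trans hh, fun z hz => hhL ⟨z, hz, rfl⟩, fun z hz => hhX (hqX hz)⟩

/-- An open interval is homeomorphic to the line with a chosen interior point going to `0`. -/
theorem exists_openEmbedding_Ioo {a e b : ℝ} (hae : a < e) (heb : e < b) :
    ∃ θ : ℝ → ℝ, IsOpenEmbedding θ ∧ StrictMono θ ∧ θ 0 = e ∧ Set.range θ = Set.Ioo a b := by
  let κ : ℝ → ℝ := fun x => orderIsoIooNegOneOne ℝ x
  have hκ : IsOpenEmbedding κ :=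
    isOpen_Ioo.isOpenEmbedding_subtypeVal.comp
      (orderIsoIooNegOneOne ℝ).toHomeomorph.isOpenEmbedding
  have hκm : StrictMono κ := fun x y hxy => (orderIsoIooNegOneOne ℝ).strictMono hxy
  have hκr : Set.range κ = Set.Ioo (-1) 1 := by
    change Set.range (Subtype.val ∘ orderIsoIooNegOneOne ℝ) = _
    rw [(orderIsoIooNegOneOne ℝ).surjective.range_comp, Subtype.range_coe]
  let A : ℝ ≃ₜ ℝ := affineHomeomorph ((b - a) / 2) ((a + b) / 2) (by linarith)
  have hA : ∀ x, A x = (b - a) / 2 * x + (a + b) / 2 := fun x => rfl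
  have hAr : Set.range (A ∘ κ) = Set.Ioo a b := by
    rw [Set.range_comp, hκr, affineHomeomorph_image_Ioo _ _ _ _ (by linarith)]
    congr 1 <;> ring
  have hAm : StrictMono (A ∘ κ) := fun x y hxy => by
    have := mul_lt_mul_of_pos_left (hκm hxy) (by linarith : 0 < (b - a) / 2)
    simp only [Function.comp, hA]
    linarith
  obtain ⟨c, hc⟩ : e ∈ Set.range (A ∘ κ) := hAr ▸ ⟨hae, heb⟩
  refine ⟨A ∘ κ ∘ Homeomorph.addRight c,
    A.isOpenEmbedding.comp (hκ.comp (Homeomorph.addRight c).isOpenEmbedding), fun x y hxy => ?_,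
    ?_, ?_⟩
  · exact hAm (by simpa using hxy : x + c < y + c)
  · simpa using hc
  · rw [← Function.comp_assoc, (Homeomorph.addRight c).surjective.range_comp, hAr]

theorem isOpenEmbedding_mk {θ₁ θ₂ : ℝ → ℝ} (h₁ : IsOpenEmbedding θ₁) (h₂ : IsOpenEmbedding θ₂) :
    IsOpenEmbedding (fun p : ℝ × ℝ => (⟨θ₁ p.1, θ₂ p.2⟩ : ℂ)) :=
  Complex.equivRealProdCLM.symm.toHomeomorph.isOpenEmbedding.comp (h₁.prodMap h₂)

/-- The function `z ↦ z - p` has a continuous logarithm on `A`. -/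
def HasLog (A : Set ℂ) (p : ℂ) : Prop :=
  ∃ g : ℂ → ℂ, ContinuousOn g A ∧ ∀ z ∈ A, Complex.exp (g z) = z - p

theorem HasLog.mono {A B : Set ℂ} {p : ℂ} (h : HasLog B p) (hAB : A ⊆ B) : HasLog A p := by
  obtain ⟨g, hg, hge⟩ := h
  exact ⟨g, hg.mono hAB, fun z hz => hge z (hAB hz)⟩

theorem hasLog_of_mul_mem_slitPlane {A : Set ℂ} {q u : ℂ} (hu : u ≠ 0)
    (h : ∀ z ∈ A, (z - q) * u ∈ Complex.slitPlane) : HasLog A q := by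
  refine ⟨fun z => Complex.log ((z - q) * u) - Complex.log u, ?_, fun z hz => ?_⟩
  · exact (ContinuousOn.clog (by fun_prop) h).sub continuousOn_const
  · rw [Complex.exp_sub, Complex.exp_log (Complex.slitPlane_ne_zero (h z hz)), Complex.exp_log hu,
      mul_div_cancel_right₀ _ hu]

theorem hasLog_of_re_lt {A : Set ℂ} {q : ℂ} {c : ℝ} (hA : ∀ z ∈ A, z.re < c) (hq : c ≤ q.re) :
    HasLog A q := by
  refine hasLog_of_mul_mem_slitPlane (u := -1) (by simp) fun z hz => Or.inl ?_
  have := hA z hz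
  simp
  linarith

theorem hasLog_of_norm_lt {A : Set ℂ} {q : ℂ} (hA : ∀ z ∈ A, ‖z‖ < 1) (hq : 1 ≤ ‖q‖) :
    HasLog A q := by
  refine hasLog_of_mul_mem_slitPlane (u := -(starRingEnd ℂ q)) ?_ fun z hz => Or.inl ?_
  · rw [neg_ne_zero, Ne, map_eq_zero]
    rintro rfl
    norm_num at hq
  · have h1 : (z * starRingEnd ℂ q).re ≤ ‖z‖ * ‖q‖ := by
      simpa using Complex.re_le_norm (z * starRingEnd ℂ q)
    have h2 : (q * starRingEnd ℂ q).re = ‖q‖ * ‖q‖ := by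
      rw [Complex.mul_conj, Complex.ofReal_re, Complex.normSq_eq_norm_sq, sq]
    have h3 : ‖z‖ * ‖q‖ < ‖q‖ * ‖q‖ :=
      mul_lt_mul_of_pos_right ((hA z hz).trans_le hq) (by linarith)
    have : (z - q) * -(starRingEnd ℂ q) = q * starRingEnd ℂ q - z * starRingEnd ℂ q := by ring
    rw [this, Complex.sub_re]
    linarith

theorem HasLog.of_joinedIn {A : Set ℂ} {p q : ℂ} (hq : HasLog A q) (hqp : JoinedIn Aᶜ q p) :
    HasLog A p := by
  obtain ⟨g, hg, hge⟩ := hq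
  obtain ⟨γ, hγ⟩ := hqp
  have hne : ∀ x : unitInterval × A, (x.2 : ℂ) - γ x.1 ≠ 0 := fun x h =>
    hγ x.1 (by rw [← sub_eq_zero.1 h]; exact x.2.2)
  let H : C(unitInterval × A, {z : ℂ // z ≠ 0}) :=
    ⟨fun x => ⟨(x.2 : ℂ) - γ x.1, hne x⟩, by fun_prop⟩
  let f : C(A, ℂ) := ⟨fun a => g a, hg.domRestrict⟩
  have H0 : ∀ a, H (0, a) = ⟨Complex.exp (f a), Complex.exp_ne_zero _⟩ := by
    intro a
    apply Subtype.ext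
    change (a : ℂ) - γ 0 = Complex.exp (g a)
    rw [hge a a.2, γ.source]
  let G := Complex.isCoveringMap_exp.liftHomotopy H f H0
  have hG : ∀ a : A, Complex.exp (G (1, a)) = a - p := by
    intro a
    have := congrArg Subtype.val (congrFun (Complex.isCoveringMap_exp.liftHomotopy_lifts H f H0)
      (1, a))
    refine Eq.trans this ?_
    change (a : ℂ) - γ 1 = _
    rw [γ.target]
  refine ⟨fun z => if hz : z ∈ A then G (1, ⟨z, hz⟩) else 0, ?_, fun z hz => ?_⟩
  · rw [continuousOn_iff_continuous_domRestrict]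
    have : A.domRestrict (fun z => if hz : z ∈ A then G (1, ⟨z, hz⟩) else 0) = fun a => G (1, a) := by
      ext a
      simp [Set.domRestrict]
    rw [this]
    fun_prop
  · simp only [dif_pos hz]
    exact hG ⟨z, hz⟩

theorem div_mem_slitPlane_of_notMem_segment {m z : ℂ} {s : ℝ} (hs : 0 < s)
    (hz : ∀ y ∈ Set.Icc (-s) s, z ≠ m + y * Complex.I) :
    (z - (m + s * Complex.I)) / (z - (m + (-s : ℝ) * Complex.I)) ∈ Complex.slitPlane := by
  have h1 : z - (m + (-s : ℝ) * Complex.I) ≠ 0 := fun h =>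
    hz (-s) ⟨le_rfl, by linarith⟩ (by linear_combination h)
  by_contra hq
  rw [Complex.mem_slitPlane_iff, not_or, not_lt, not_not] at hq
  set q := (z - (m + s * Complex.I)) / (z - (m + (-s : ℝ) * Complex.I)) with hqdef
  obtain ⟨t, ht, hqt⟩ : ∃ t : ℝ, 0 ≤ t ∧ q = -(t : ℂ) :=
    ⟨-q.re, by linarith [hq.1], by apply Complex.ext <;> simp [hq.2]⟩
  rw [hqdef, div_eq_iff h1] at hqt
  have ht1 : (1 + t : ℂ) ≠ 0 := by
    rw [← Complex.ofReal_one, ← Complex.ofReal_add, Complex.ofReal_ne_zero]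
    positivity
  refine hz (s * (1 - t) / (1 + t)) ⟨?_, ?_⟩ ?_
  · rw [le_div_iff₀ (by positivity)]; nlinarith
  · rw [div_le_iff₀ (by positivity)]; nlinarith
  · push_cast at hqt ⊢
    field_simp
    linear_combination hqt

theorem log_ratio_eq {s ε : ℝ} (hε : 0 < ε) :
    Complex.log ((ε - s * Complex.I) / (ε + s * Complex.I)) =
      -(2 * Complex.arg (ε + s * Complex.I) : ℝ) * Complex.I ∧
    Complex.log ((-ε - s * Complex.I) / (-ε + s * Complex.I)) =
      (2 * Complex.arg (ε + s * Complex.I) : ℝ) * Complex.I := by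
  set u : ℂ := ε + s * Complex.I with hu
  have hure : u.re = ε := by simp [hu]
  have hu0 : u ≠ 0 := fun h => by rw [h] at hure; simp at hure; linarith
  have harg : |u.arg| < Real.pi / 2 := Complex.abs_arg_lt_pi_div_two_iff.2 (Or.inl (by linarith))
  rw [abs_lt] at harg
  have hexp : u = ‖u‖ * Complex.exp (u.arg * Complex.I) := (Complex.norm_mul_exp_arg_mul_I u).symm
  have hconj : starRingEnd ℂ u = ‖u‖ * Complex.exp (-(u.arg * Complex.I)) := by
    conv_lhs => rw [hexp]
    rw [map_mul, Complex.conj_ofReal, ← Complex.exp_conj, map_mul, Complex.conj_ofReal,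
      Complex.conj_I, mul_neg]
  have hcu : starRingEnd ℂ u = ε - s * Complex.I := by
    simp [hu, sub_eq_add_neg]
  have hn : (‖u‖ : ℂ) ≠ 0 := by simpa using hu0
  have h1 : (ε - s * Complex.I) / u = Complex.exp (-(2 * u.arg : ℝ) * Complex.I) := by
    have : (ε - s * Complex.I) / u = (‖u‖ * Complex.exp (-(u.arg * Complex.I))) /
        (‖u‖ * Complex.exp (u.arg * Complex.I)) := by rw [← hconj, ← hexp, hcu]
    rw [this, mul_div_mul_left _ _ hn, ← Complex.exp_sub]
    congr 1
    push_cast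
    ring
  have h2 : (-ε - s * Complex.I) / (-ε + s * Complex.I) =
      Complex.exp ((2 * u.arg : ℝ) * Complex.I) := by
    have : (-ε - s * Complex.I) / (-ε + s * Complex.I) = ((ε - s * Complex.I) / u)⁻¹ := by
      rw [inv_div, hu, ← neg_div_neg_eq]
      ring_nf
    rw [this, h1, ← Complex.exp_neg, neg_mul, neg_neg]
  rw [h1, h2]
  constructor <;> apply Complex.log_exp <;> simp <;> linarith

/-- A connected set cannot touch both sides of a vertical segment it misses, when the logarithms
based at the two end points extend across the segment. -/
theorem false_of_hasLog {E Z : Set ℂ} {m : ℂ} {s : ℝ} (hs : 0 < s) (hE : IsPreconnected E)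
    (hEZ : E ⊆ Z) (hm : m ∈ Z) (h₁ : HasLog Z (m + s * Complex.I))
    (h₂ : HasLog Z (m + (-s : ℝ) * Complex.I))
    (hmiss : ∀ y ∈ Set.Icc (-s) s, m + y * Complex.I ∉ E)
    (hnear : ∀ᶠ ε : ℝ in 𝓝[>] 0, m + ε ∈ E ∧ m - ε ∈ E) : False := by
  obtain ⟨g₁, hg₁, he₁⟩ := h₁
  obtain ⟨g₂, hg₂, he₂⟩ := h₂
  let R : ℂ → ℂ := fun z => (z - (m + s * Complex.I)) / (z - (m + (-s : ℝ) * Complex.I))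
  have hR : ∀ z ∈ E, R z ∈ Complex.slitPlane := fun z hz =>
    div_mem_slitPlane_of_notMem_segment hs fun y hy h => hmiss y hy (h ▸ hz)
  let D : ℂ → ℂ := fun z => g₁ z - g₂ z - Complex.log (R z)
  have hDc : ContinuousOn D E := by
    refine ((hg₁.mono hEZ).sub (hg₂.mono hEZ)).sub (ContinuousOn.clog ?_ hR)
    refine ContinuousOn.div (by fun_prop) (by fun_prop) fun z hz => ?_
    rw [← he₂ z (hEZ hz)]
    exact Complex.exp_ne_zero _
  have hDT : Set.MapsTo D E ((fun z : ℂ => (⟨_, z.exp_ne_zero⟩ : {z : ℂ // z ≠ 0})) ⁻¹'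
      {⟨1, one_ne_zero⟩}) := by
    intro z hz
    refine Subtype.ext ?_
    change Complex.exp (g₁ z - g₂ z - Complex.log (R z)) = 1
    rw [Complex.exp_sub, Complex.exp_sub, Complex.exp_log (Complex.slitPlane_ne_zero (hR z hz)),
      he₁ z (hEZ hz), he₂ z (hEZ hz)]
    exact div_self (Complex.slitPlane_ne_zero (hR z hz))
  have hdisc := (Complex.isCoveringMap_exp ⟨1, one_ne_zero⟩).1
  have hconst : ∀ z ∈ E, ∀ w ∈ E, D z = D w := fun z hz w hw =>
    hE.constant_of_mapsTo ⟨hdisc⟩ hDc hDT hz hw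
  have hG : ContinuousWithinAt (fun z => g₁ z - g₂ z) Z m := (hg₁.sub hg₂) m hm
  have lim : ∀ σ : ℝ, (∀ᶠ ε : ℝ in 𝓝[>] 0, m + σ * ε ∈ E) →
      Tendsto (fun ε : ℝ => g₁ (m + σ * ε) - g₂ (m + σ * ε)) (𝓝[>] 0) (𝓝 (g₁ m - g₂ m)) := by
    intro σ hσ
    refine hG.tendsto.comp (tendsto_nhdsWithin_iff.2 ⟨?_, hσ.mono fun ε h => hEZ h⟩)
    have : Continuous fun ε : ℝ => m + σ * ε := by fun_prop
    simpa using (this.tendsto 0).mono_left nhdsWithin_le_nhds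
  have lim1 := lim 1 (hnear.mono fun ε h => by simpa using h.1)
  have lim2 := lim (-1) (hnear.mono fun ε h => by simpa [← sub_eq_add_neg] using h.2)
  have lim3 : Tendsto (fun ε : ℝ => (4 * Complex.arg (ε + s * Complex.I) : ℝ) * Complex.I)
      (𝓝[>] 0) (𝓝 0) := by
    rw [← sub_self (g₁ m - g₂ m)]
    refine (lim2.sub lim1).congr' ?_
    filter_upwards [hnear, self_mem_nhdsWithin] with ε hε hε0
    have h := hconst _ hε.1 _ hε.2
    simp only [D, R] at h
    have e1 : (m + ε - (m + s * Complex.I)) / (m + ε - (m + (-s : ℝ) * Complex.I)) =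
        (ε - s * Complex.I) / (ε + s * Complex.I) := by push_cast; ring_nf
    have e2 : (m - ε - (m + s * Complex.I)) / (m - ε - (m + (-s : ℝ) * Complex.I)) =
        (-ε - s * Complex.I) / (-ε + s * Complex.I) := by push_cast; ring_nf
    rw [e1, e2, (log_ratio_eq hε0).1, (log_ratio_eq hε0).2] at h
    push_cast at h ⊢
    simp only [one_mul, neg_mul, ← sub_eq_add_neg] at h ⊢
    linear_combination -h
  have lim4 : Tendsto (fun ε : ℝ => (4 * Complex.arg (ε + s * Complex.I) : ℝ) * Complex.I)
      (𝓝[>] 0) (𝓝 ((4 * (Real.pi / 2) : ℝ) * Complex.I)) := by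
    have h1 : Complex.arg (((0 : ℝ) : ℂ) + s * Complex.I) = Real.pi / 2 := by
      rw [Complex.ofReal_zero, zero_add, Complex.arg_real_mul _ hs, Complex.arg_I]
    have h2 : ContinuousAt (fun ε : ℝ => Complex.arg (ε + s * Complex.I)) 0 := by
      refine ContinuousAt.comp (g := Complex.arg) (Complex.continuousAt_arg ?_) (by fun_prop)
      right
      simp [hs.ne']
    have h3 := h2.tendsto
    rw [h1] at h3
    exact ((Complex.continuous_ofReal.tendsto _).comp
      ((h3.const_mul 4).mono_left nhdsWithin_le_nhds)).mul_const _
  have := tendsto_nhds_unique lim3 lim4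
  simp [Real.pi_ne_zero] at this

/-- Left end of the smallest closed grid column around `x`; the grid is `ℕ ⊆ ℝ`. -/
def gridLo (x : ℝ) : ℝ := if x ≤ 0 then x else ⌈x⌉ - 1

/-- Right end of the smallest closed grid column around `x`; the grid is `ℕ ⊆ ℝ`. -/
def gridHi (x : ℝ) : ℝ := if x < 0 then x else ⌊x⌋ + 1

theorem gridLo_le (x : ℝ) : gridLo x ≤ x := by
  unfold gridLo
  split_ifs
  · rfl
  · linarith [Int.ceil_lt_add_one x]

theorem le_gridHi (x : ℝ) : x ≤ gridHi x := by
  unfold gridHi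
  split_ifs
  · rfl
  · exact (Int.lt_floor_add_one x).le

theorem gridHi_le (x : ℝ) : gridHi x ≤ x + 1 := by
  unfold gridHi
  split_ifs
  · linarith
  · linarith [Int.floor_le x]

theorem le_gridLo (x : ℝ) : x - 1 ≤ gridLo x := by
  unfold gridLo
  split_ifs
  · linarith
  · linarith [Int.le_ceil x]

theorem gridLo_mono : Monotone gridLo := by
  intro x y hxy
  unfold gridLo
  split_ifs with h1 h2 h2
  · exact hxy
  · have : (1 : ℝ) ≤ ⌈y⌉ := by exact_mod_cast Int.one_le_ceil_iff.2 (not_le.1 h2)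
    linarith
  · linarith
  · have : (⌈x⌉ : ℝ) ≤ ⌈y⌉ := by exact_mod_cast Int.ceil_mono hxy
    linarith

theorem gridHi_mono : Monotone gridHi := by
  intro x y hxy
  unfold gridHi
  split_ifs with h1 h2 h2
  · exact hxy
  · linarith [Int.lt_floor_add_one y]
  · linarith
  · have : (⌊x⌋ : ℝ) ≤ ⌊y⌋ := by exact_mod_cast Int.floor_mono hxy
    linarith

theorem grid_of_mem_Ioo {k : ℤ} (hk : 0 ≤ k) {x : ℝ} (h1 : k < x) (h2 : x < k + 1) :
    gridLo x = k ∧ gridHi x = k + 1 := by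
  have hk' : (0 : ℝ) ≤ k := by exact_mod_cast hk
  have hc : ⌈x⌉ = k + 1 := by
    rw [Int.ceil_eq_iff]; push_cast; constructor <;> linarith
  have hf : ⌊x⌋ = k := by
    rw [Int.floor_eq_iff]; constructor <;> linarith
  unfold gridLo gridHi
  rw [if_neg (by linarith), if_neg (by linarith), hc, hf]
  push_cast
  constructor <;> ring

theorem grid_intCast {k : ℤ} (hk : 1 ≤ k) : gridLo k = k - 1 ∧ gridHi k = k + 1 := by
  have hk' : (1 : ℝ) ≤ k := by exact_mod_cast hk
  unfold gridLo gridHi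
  rw [if_neg (by linarith), if_neg (by linarith), Int.ceil_intCast, Int.floor_intCast]
  exact ⟨rfl, rfl⟩

theorem mem_Ioo_of_grid {k : ℤ} {x : ℝ} (hx : 0 < x) (h1 : gridLo x = k)
    (h2 : gridHi x = k + 1) : k < x ∧ x < k + 1 := by
  unfold gridLo at h1
  unfold gridHi at h2
  rw [if_neg (by linarith)] at h1 h2
  constructor
  · linarith [Int.ceil_lt_add_one x]
  · linarith [Int.lt_floor_add_one x]

theorem eq_of_grid {k : ℤ} {x : ℝ} (hx : 0 < x) (h1 : gridLo x = k - 1)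
    (h2 : gridHi x = k + 1) : x = k := by
  unfold gridLo at h1
  unfold gridHi at h2
  rw [if_neg (by linarith)] at h1 h2
  linarith [Int.le_ceil x, Int.floor_le x]

theorem grid_near (x : ℝ) : ∀ᶠ x' in 𝓝 x, ∀ t ∈ Set.Icc (gridLo x') (gridHi x'),
    t ∈ Set.Icc (gridLo x) (gridHi x) ∨ t = x' := by
  rcases lt_or_ge x 0 with hx | hx
  · filter_upwards [gt_mem_nhds hx] with x' hx' t ht
    right
    unfold gridLo gridHi at ht
    rw [if_pos hx'.le, if_pos hx'] at ht
    exact le_antisymm ht.2 ht.1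
  · have h1 : ∀ᶠ x' : ℝ in 𝓝 x, x' < ⌊x⌋ + 1 := gt_mem_nhds (Int.lt_floor_add_one x)
    have h2 : ∀ᶠ x' : ℝ in 𝓝 x, (⌈x⌉ - 1 : ℝ) < x' :=
      lt_mem_nhds (by linarith [Int.ceil_lt_add_one x])
    filter_upwards [h1, h2] with x' h1 h2 t ht
    rcases lt_or_ge x' 0 with hx' | hx'
    · right
      unfold gridLo gridHi at ht
      rw [if_pos hx'.le, if_pos hx'] at ht
      exact le_antisymm ht.2 ht.1
    left
    have hf : (⌊x'⌋ : ℝ) ≤ ⌊x⌋ := by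
      exact_mod_cast Int.lt_add_one_iff.1 (Int.floor_lt.2 (by exact_mod_cast h1))
    have hc : (⌈x⌉ : ℝ) ≤ ⌈x'⌉ := by
      have := Int.lt_ceil (a := x') (z := ⌈x⌉ - 1) |>.2 (by push_cast; exact h2)
      exact_mod_cast (by omega : ⌈x⌉ ≤ ⌈x'⌉)
    refine ⟨le_trans ?_ ht.1, ht.2.trans ?_⟩
    · unfold gridLo
      split_ifs with a b b
      · have : x = 0 := le_antisymm a hx
        linarith
      · have : (1 : ℝ) ≤ ⌈x'⌉ := by exact_mod_cast Int.one_le_ceil_iff.2 (not_le.1 b)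
        linarith
      · have : (1 : ℝ) ≤ ⌈x⌉ := by exact_mod_cast Int.one_le_ceil_iff.2 (not_le.1 a)
        have : x' = 0 := le_antisymm b hx'
        rw [this, Int.ceil_zero] at hc
        push_cast at hc
        linarith
      · linarith
    · unfold gridHi
      rw [if_neg (by linarith), if_neg (by linarith)]
      linarith

/-- The points of `ω` whose whole horizontal segment across the surrounding grid column lies
in `ω`. -/
def gridPart (ω : Set ℂ) : Set ℂ :=
  {w | ∀ x ∈ Set.Icc (gridLo w.re) (gridHi w.re), (⟨x, w.im⟩ : ℂ) ∈ ω}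

theorem gridPart_subset (ω : Set ℂ) : gridPart ω ⊆ ω :=
  fun w hw => hw w.re ⟨gridLo_le _, le_gridHi _⟩

theorem continuous_mk_complex {X : Type*} [TopologicalSpace X] {f g : X → ℝ} (hf : Continuous f)
    (hg : Continuous g) : Continuous (fun x => (⟨f x, g x⟩ : ℂ)) :=
  Complex.equivRealProdCLM.symm.continuous.comp (hf.prodMk hg)

theorem isOpen_gridPart {ω : Set ℂ} (ho : IsOpen ω) : IsOpen (gridPart ω) := by
  rw [isOpen_iff_mem_nhds]
  intro w hw
  have h1 : ∀ᶠ y in 𝓝 w.im, ∀ x ∈ Set.Icc (gridLo w.re) (gridHi w.re), (⟨x, y⟩ : ℂ) ∈ ω := by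
    refine isCompact_Icc.eventually_forall_of_forall_eventually fun x hx => ?_
    have : Continuous fun z : ℝ × ℝ => (⟨z.2, z.1⟩ : ℂ) :=
      continuous_mk_complex continuous_snd continuous_fst
    have := (ho.preimage this).mem_nhds (x := (w.im, x)) (hw x hx)
    exact this
  filter_upwards [ho.mem_nhds (gridPart_subset ω hw),
    Complex.continuous_im.continuousAt.eventually h1,
    Complex.continuous_re.continuousAt.eventually (grid_near w.re)] with w' h1 h2 h3 x hx
  rcases h3 x hx with h | rfl
  · exact h2 x h
  · exact h1

/-- `w` and `w'` lie in the same open column or on the same grid line. -/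
def SameColumn (x x' : ℝ) : Prop := 0 < x ∧ 0 < x' ∧ gridLo x = gridLo x' ∧ gridHi x = gridHi x'

theorem SameColumn.mk_mem {ω : Set ℂ} {x x' y : ℝ} (h : SameColumn x x')
    (hx : (⟨x, y⟩ : ℂ) ∈ gridPart ω) : (⟨x', y⟩ : ℂ) ∈ gridPart ω := by
  intro t ht
  rw [← h.2.2.1, ← h.2.2.2] at ht
  exact hx t ht

theorem sameColumn_of_mem_Ioo {k : ℤ} (hk : 0 ≤ k) {x x' : ℝ} (hx : x ∈ Set.Ioo (k : ℝ) (k + 1))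
    (hx' : x' ∈ Set.Ioo (k : ℝ) (k + 1)) : SameColumn x x' := by
  have h := grid_of_mem_Ioo hk hx.1 hx.2
  have h' := grid_of_mem_Ioo hk hx'.1 hx'.2
  have hk' : (0 : ℝ) ≤ k := by exact_mod_cast hk
  exact ⟨hk'.trans_lt hx.1, hk'.trans_lt hx'.1, h.1.trans h'.1.symm, h.2.trans h'.2.symm⟩

theorem SameColumn.mem_Ioo {k : ℤ} (hk : 0 ≤ k) {x x' : ℝ} (h : SameColumn x x')
    (hx : x ∈ Set.Ioo (k : ℝ) (k + 1)) : x' ∈ Set.Ioo (k : ℝ) (k + 1) := by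
  obtain ⟨h1, h2⟩ := grid_of_mem_Ioo hk hx.1 hx.2
  exact mem_Ioo_of_grid h.2.1 (h.2.2.1.symm.trans h1) (h.2.2.2.symm.trans h2)

theorem SameColumn.eq_intCast {k : ℤ} (hk : 1 ≤ k) {x' : ℝ} (h : SameColumn k x') : x' = k := by
  obtain ⟨h1, h2⟩ := grid_intCast hk
  exact eq_of_grid h.2.1 (h.2.2.1.symm.trans h1) (h.2.2.2.symm.trans h2)

/-- `E` is a union of cells of the grid decomposition of `gridPart ω`, to the right of the
imaginary axis. -/
def Saturated (ω E : Set ℂ) : Prop :=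
  ∀ w w' : ℂ, SameColumn w.re w'.re →
    (∀ y ∈ Set.uIcc w.im w'.im, (⟨w.re, y⟩ : ℂ) ∈ gridPart ω) → w ∈ E → w' ∈ E

theorem saturated_connectedComponentIn {ω : Set ℂ} (v : ℕ) (p : ℂ) :
    Saturated ω (connectedComponentIn (gridPart ω ∩ {w | w.re < v}) p) := by
  intro w w' hc hseg hw
  have hwS : w ∈ gridPart ω ∩ {w | w.re < v} := connectedComponentIn_subset _ _ hw
  have hv : gridHi w.re ≤ v := by
    unfold gridHi
    rw [if_neg (not_lt.2 hc.1.le)]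
    have : ⌊w.re⌋ < (v : ℤ) := Int.floor_lt.2 (by exact_mod_cast hwS.2)
    exact_mod_cast this
  have hw'v : w'.re < v := by
    have : gridHi w'.re ≤ v := by rwa [← hc.2.2.2]
    unfold gridHi at this
    rw [if_neg (not_lt.2 hc.2.1.le)] at this
    linarith [Int.lt_floor_add_one w'.re]
  let B : Set ℂ := Set.uIcc w.re w'.re ×ℂ Set.uIcc w.im w'.im
  have hBc : IsPreconnected B := by
    have := (isPreconnected_uIcc (a := w.re) (b := w'.re)).prod
      (isPreconnected_uIcc (a := w.im) (b := w'.im))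
    convert this.image (fun q : ℝ × ℝ => (⟨q.1, q.2⟩ : ℂ))
      (continuous_mk_complex continuous_fst continuous_snd).continuousOn
    ext u
    constructor
    · exact fun hu => ⟨(u.re, u.im), hu, rfl⟩
    · rintro ⟨q, hq, rfl⟩
      exact hq
  have hBS : B ⊆ gridPart ω ∩ {w | w.re < v} := by
    rintro u ⟨hu1, hu2⟩
    have hu1' : u.re ∈ Set.uIcc w.re w'.re := hu1
    refine ⟨?_, hu1'.2.trans_lt (max_lt hwS.2 hw'v)⟩
    refine SameColumn.mk_mem (x := w.re) (x' := u.re) (y := u.im) ⟨hc.1, ?_, ?_, ?_⟩ (hseg _ hu2)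
    · exact (lt_min hc.1 hc.2.1).trans_le hu1'.1
    · rcases Set.mem_uIcc.1 hu1' with h | h
      · exact le_antisymm (gridLo_mono h.1) (hc.2.2.1 ▸ gridLo_mono h.2)
      · exact le_antisymm (hc.2.2.1 ▸ gridLo_mono h.1) (gridLo_mono h.2)
    · rcases Set.mem_uIcc.1 hu1' with h | h
      · exact le_antisymm (gridHi_mono h.1) (hc.2.2.2 ▸ gridHi_mono h.2)
      · exact le_antisymm (hc.2.2.2 ▸ gridHi_mono h.1) (gridHi_mono h.2)
  have hwB : w ∈ B := ⟨Set.left_mem_uIcc, Set.left_mem_uIcc⟩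
  have hw'B : w' ∈ B := ⟨Set.right_mem_uIcc, Set.right_mem_uIcc⟩
  have := hBc.subset_connectedComponentIn hwB hBS
  rw [connectedComponentIn_eq hw]
  exact this hw'B

/-- The maximal open interval around a point of an open set of reals. -/
theorem exists_maximal_Ioo {U : Set ℝ} (hU : IsOpen U) {y y₁ y₂ : ℝ} (hy : y ∈ U)
    (h₁ : y₁ < y) (h₁U : y₁ ∉ U) (h₂ : y < y₂) (h₂U : y₂ ∉ U) :
    ∃ a b, a < y ∧ y < b ∧ Set.Ioo a b ⊆ U ∧ a ∉ U ∧ b ∉ U := by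
  have hc : IsClosed Uᶜ := hU.isClosed_compl
  have hA : IsCompact (Set.Icc y₁ y ∩ Uᶜ) := isCompact_Icc.inter_right hc
  have hB : IsCompact (Set.Icc y y₂ ∩ Uᶜ) := isCompact_Icc.inter_right hc
  obtain ⟨a, ha, hamax⟩ := hA.exists_isGreatest ⟨y₁, ⟨le_rfl, h₁.le⟩, h₁U⟩
  obtain ⟨b, hb, hbmin⟩ := hB.exists_isLeast ⟨y₂, ⟨h₂.le, le_rfl⟩, h₂U⟩
  have hay : a < y := lt_of_le_of_ne ha.1.2 fun h => ha.2 (h ▸ hy)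
  have hyb : y < b := lt_of_le_of_ne hb.1.1 fun h => hb.2 (h ▸ hy)
  refine ⟨a, b, hay, hyb, fun t ht => ?_, ha.2, hb.2⟩
  by_contra htU
  rcases le_total t y with h | h
  · exact absurd (hamax ⟨⟨ha.1.1.trans ht.1.le, h⟩, htU⟩) (not_le.2 ht.1)
  · exact absurd (hbmin ⟨⟨h, ht.2.le.trans hb.1.2⟩, htU⟩) (not_le.2 ht.2)

theorem mem_Ioo_of_uIcc_subset {U : Set ℝ} {a b y y' : ℝ} (hy : y ∈ Set.Ioo a b) (ha : a ∉ U)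
    (hb : b ∉ U) (h : ∀ t ∈ Set.uIcc y y', t ∈ U) : y' ∈ Set.Ioo a b := by
  constructor
  · by_contra hc
    exact ha (h a (Set.mem_uIcc.2 (Or.inr ⟨not_lt.1 hc, hy.1.le⟩)))
  · by_contra hc
    exact hb (h b (Set.mem_uIcc.2 (Or.inl ⟨hy.2.le, not_lt.1 hc⟩)))

/-- End points of a maximal arc of a grid line escape to infinity off `gridPart ω`. -/
theorem hasLog_gridPart {ω : Set ℂ} (ho : IsOpen ω) {c : ℝ} (hc : ∀ w ∈ ω, w.re < c)
    (hesc : ∀ q ∈ closure ω, q ∉ ω → ∃ q' : ℂ, c ≤ q'.re ∧ JoinedIn ωᶜ q' q) {k : ℤ} (hk : 1 ≤ k)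
    {y : ℝ} (hq : (⟨k, y⟩ : ℂ) ∉ gridPart ω) (hqc : (⟨k, y⟩ : ℂ) ∈ closure ω) :
    HasLog (gridPart ω) (⟨k, y⟩ : ℂ) := by
  have hmap : Continuous fun x : ℝ => (⟨x, y⟩ : ℂ) := continuous_mk_complex continuous_id continuous_const
  obtain ⟨hlo, hhi⟩ := grid_intCast hk
  obtain ⟨x₁, hx₁, hx₁ω⟩ : ∃ x₁ ∈ Set.Icc ((k : ℝ) - 1) (k + 1), (⟨x₁, y⟩ : ℂ) ∉ ω := by
    by_contra! h
    refine hq fun x hx => h x ?_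
    simpa only [hlo, hhi] using hx
  have havoid : ∀ x ∈ Set.uIcc (k : ℝ) x₁, (⟨x, y⟩ : ℂ) ∉ gridPart ω := by
    intro x hx hxZ
    refine hx₁ω (hxZ x₁ ?_)
    rcases Set.mem_uIcc.1 hx with h | h
    · exact ⟨(gridLo_le x).trans h.2, hx₁.2.trans (hhi ▸ gridHi_mono h.1)⟩
    · exact ⟨(gridLo_mono h.2).trans (hlo.trans_le hx₁.1), h.1.trans (le_gridHi x)⟩
  obtain ⟨x₂, hx₂, hx₂c, hx₂ω⟩ : ∃ x₂ ∈ Set.uIcc (k : ℝ) x₁, (⟨x₂, y⟩ : ℂ) ∈ closure ω ∧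
      (⟨x₂, y⟩ : ℂ) ∉ ω := by
    by_cases hqω : (⟨k, y⟩ : ℂ) ∈ ω
    · have hS : IsPreconnected ((fun x : ℝ => (⟨x, y⟩ : ℂ)) '' Set.uIcc (k : ℝ) x₁) :=
        isPreconnected_uIcc.image _ hmap.continuousOn
      by_contra! hno
      refine hx₁ω (hS.subset_of_closure_inter_subset ho ⟨_, ⟨k, Set.left_mem_uIcc, rfl⟩, hqω⟩ ?_
        ⟨x₁, Set.right_mem_uIcc, rfl⟩)
      rintro _ ⟨hcl, x₂, hx₂, rfl⟩
      exact hno x₂ hx₂ hcl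
    · exact ⟨k, Set.left_mem_uIcc, hqc, hqω⟩
  obtain ⟨q', hq', hj⟩ := hesc _ hx₂c hx₂ω
  have hbase : HasLog (gridPart ω) q' := hasLog_of_re_lt (fun z hz => hc z (gridPart_subset _ hz)) hq'
  refine (hbase.of_joinedIn (hj.mono ?_)).of_joinedIn ?_
  · exact Set.compl_subset_compl.2 (gridPart_subset ω)
  · refine JoinedIn.of_segment_subset ?_
    intro u hu
    obtain ⟨a, b, ha, hb, hab, rfl⟩ := hu
    have : (a • (⟨x₂, y⟩ : ℂ) + b • (⟨k, y⟩ : ℂ)) = ⟨a * x₂ + b * k, y⟩ := by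
      apply Complex.ext
      · simp
      · simp only [Complex.add_im, Complex.smul_im, smul_eq_mul]
        rw [← add_mul, hab, one_mul]
    rw [this]
    exact havoid _ (convex_uIcc (k : ℝ) x₁ hx₂ Set.left_mem_uIcc ha hb hab)

theorem mem_gridPart_of_grid_le {ω : Set ℂ} {x x' y : ℝ} (h : (⟨x, y⟩ : ℂ) ∈ gridPart ω)
    (hlo : gridLo x ≤ gridLo x') (hhi : gridHi x' ≤ gridHi x) : (⟨x', y⟩ : ℂ) ∈ gridPart ω :=
  fun t ht => h t ⟨hlo.trans ht.1, ht.2.trans hhi⟩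

/-- Attaching a rectangle that fills the width of a grid column. -/
theorem Pushable.attach_column {ω X₀ E : Set ℂ} (hP : Pushable ω X₀ E) (hE : IsOpen E) (j : ℤ)
    {η : ℝ → ℝ} (hη : IsOpenEmbedding η)
    (hω : ∀ x ∈ Set.Ioo (j : ℝ) (j + 1), ∀ t, (⟨x, η t⟩ : ℂ) ∈ ω)
    (hleft : ∀ x ∈ Set.Ioo (j : ℝ) (j + 1), ∀ t < 0, (⟨x, η t⟩ : ℂ) ∈ E)
    (hEη : ∀ x ∈ Set.Ioo (j : ℝ) (j + 1), ∀ t, ∀ t' ≤ t, (⟨x, η t⟩ : ℂ) ∈ E → (⟨x, η t'⟩ : ℂ) ∈ E)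
    (hX : ∀ x ∈ Set.Ioo (j : ℝ) (j + 1), ∀ t, (⟨x, η t⟩ : ℂ) ∉ X₀) :
    Pushable ω X₀ (E ∪ {w | w.re ∈ Set.Ioo (j : ℝ) (j + 1) ∧ w.im ∈ Set.range η}) ∧
      IsOpen (E ∪ {w | w.re ∈ Set.Ioo (j : ℝ) (j + 1) ∧ w.im ∈ Set.range η}) := by
  obtain ⟨θ, hθ, -, -, hθr⟩ := exists_openEmbedding_Ioo (a := (j : ℝ)) (e := j + 1 / 2) (b := j + 1)
    (by linarith) (by linarith)
  have hmem : ∀ s, θ s ∈ Set.Ioo (j : ℝ) (j + 1) := fun s => hθr ▸ Set.mem_range_self s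
  have hψ : IsOpenEmbedding fun p : ℝ × ℝ => (⟨θ p.2, η p.1⟩ : ℂ) :=
    (isOpenEmbedding_mk hθ hη).comp (Homeomorph.prodComm ℝ ℝ).isOpenEmbedding
  have hr : Set.range (fun p : ℝ × ℝ => (⟨θ p.2, η p.1⟩ : ℂ)) =
      {w | w.re ∈ Set.Ioo (j : ℝ) (j + 1) ∧ w.im ∈ Set.range η} := by
    ext w
    constructor
    · rintro ⟨p, rfl⟩
      exact ⟨hmem _, p.1, rfl⟩
    · rintro ⟨h1, t, h2⟩
      rw [← hθr] at h1
      obtain ⟨s, h1⟩ := h1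
      exact ⟨(t, s), Complex.ext h1 h2⟩
  rw [← hr]
  refine ⟨hP.attach hE hψ ?_ (fun p hp => hleft _ (hmem _) _ hp) ?_ ?_, hE.union hψ.isOpen_range⟩
  · rintro _ ⟨p, rfl⟩
    exact hω _ (hmem _) _
  · intro p p' h2 h1 h
    simp only [h2] at *
    exact hEη _ (hmem _) _ _ h1 h
  · intro p p' _ _ h
    exact absurd h (hX _ (hmem _) _)

/-- The sets that occur while the component `X₀` of `gridPart ω` is enlarged. -/
structure Engulfed (ω X₀ E : Set ℂ) : Prop where
  isOpen : IsOpen E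
  base : X₀ ⊆ E
  subset : E ⊆ gridPart ω
  preconnected : IsPreconnected E
  saturated : Saturated ω E
  pushable : Pushable ω X₀ E

theorem Engulfed.exists_attach {ω X₀ E : Set ℂ} (hE : Engulfed ω X₀ E) (hX : Saturated ω X₀)
    {k i j : ℤ} (hk : 1 ≤ k) (hi : 0 ≤ i) (hj : 0 ≤ j) (hjk : k ≤ j + 1) (hjk' : j ≤ k)
    {ξ : ℝ → ℝ} (hξ : IsOpenEmbedding ξ) (hξ0 : ξ 0 = k)
    (hneg : ∀ s < 0, ξ s ∈ Set.Ioo (i : ℝ) (i + 1)) (hpos : ∀ s > 0, ξ s ∈ Set.Ioo (j : ℝ) (j + 1))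
    (hsurj : Set.Ioo (j : ℝ) (j + 1) ⊆ ξ '' Set.Ioi 0) {α β y₀ : ℝ} (hαy : α < y₀) (hyβ : y₀ < β)
    (hJ : ∀ y ∈ Set.Ioo α β, (⟨k, y⟩ : ℂ) ∈ gridPart ω) (hα : (⟨k, α⟩ : ℂ) ∉ gridPart ω)
    (hβ : (⟨k, β⟩ : ℂ) ∉ gridPart ω)
    (hin : ∀ x ∈ Set.Ioo (i : ℝ) (i + 1), ∀ y ∈ Set.Ioo α β, (⟨x, y⟩ : ℂ) ∈ E)
    (hout : ∀ x ∈ Set.Ioo (j : ℝ) (j + 1), (⟨x, y₀⟩ : ℂ) ∉ E) (hz : (⟨k, y₀⟩ : ℂ) ∉ E)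
    {T : ℝ} (hT : 0 < T) (hper : ∀ w ∈ ω, w + T * Complex.I ∉ ω) (ho : IsOpen ω) :
    ∃ E', Engulfed ω X₀ E' ∧ E ⊆ E' ∧ (⟨k, y₀⟩ : ℂ) ∈ E' := by
  have hy₀ : y₀ ∈ Set.Ioo α β := ⟨hαy, hyβ⟩
  obtain ⟨hklo, hkhi⟩ := grid_intCast hk
  have hk0 : (0 : ℝ) < k := by exact_mod_cast (by omega : 0 < k)
  have hj0 : (0 : ℝ) ≤ j := by exact_mod_cast hj
  have hjkr : (k : ℝ) - 1 ≤ j := by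
    have : (k : ℝ) ≤ j + 1 := by exact_mod_cast hjk
    linarith
  have hjkr' : (j : ℝ) ≤ k := by exact_mod_cast hjk'
  have hkj : ∀ x ∈ Set.Ioo (j : ℝ) (j + 1), ∀ y, (⟨k, y⟩ : ℂ) ∈ gridPart ω →
      (⟨x, y⟩ : ℂ) ∈ gridPart ω := by
    intro x hx y hy
    obtain ⟨h1, h2⟩ := grid_of_mem_Ioo hj hx.1 hx.2
    exact mem_gridPart_of_grid_le hy (by rw [h1, hklo]; exact hjkr)
      (by rw [h2, hkhi]; linarith)
  set xo : ℝ := j + 1 / 2 with hxo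
  have hxom : xo ∈ Set.Ioo (j : ℝ) (j + 1) := ⟨by linarith, by linarith⟩
  let U : Set ℝ := {y | (⟨xo, y⟩ : ℂ) ∈ gridPart ω}
  have hU : IsOpen U := (isOpen_gridPart ho).preimage
    (continuous_mk_complex continuous_const continuous_id)
  have hJU : Set.Ioo α β ⊆ U := fun y hy => hkj _ hxom _ (hJ y hy)
  have hy₀U : y₀ ∈ U := hJU hy₀
  have hup : y₀ + T ∉ U := by
    intro h
    refine hper _ (gridPart_subset ω hy₀U) ?_
    convert gridPart_subset ω h using 1
    apply Complex.ext <;> simp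
  have hdn : y₀ - T ∉ U := by
    intro h
    refine hper _ (gridPart_subset ω h) ?_
    convert gridPart_subset ω hy₀U using 1
    apply Complex.ext <;> simp
  obtain ⟨a, b, hay, hyb, habU, haU, hbU⟩ :=
    exists_maximal_Ioo hU hy₀U (by linarith) hdn (by linarith) hup
  have haα : a ≤ α := by
    by_contra h
    exact haU (hJU ⟨not_le.1 h, hay.trans hyβ⟩)
  have hβb : β ≤ b := by
    by_contra h
    exact hbU (hJU ⟨hαy.trans hyb, not_le.1 h⟩)
  have hcolZ : ∀ x ∈ Set.Ioo (j : ℝ) (j + 1), ∀ y ∈ Set.Ioo a b, (⟨x, y⟩ : ℂ) ∈ gridPart ω :=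
    fun x hx y hy => (sameColumn_of_mem_Ioo hj hxom hx).mk_mem (habU hy)
  have hcolE : ∀ x ∈ Set.Ioo (j : ℝ) (j + 1), ∀ y ∈ Set.Ioo a b, (⟨x, y⟩ : ℂ) ∉ E := by
    intro x hx y hy h
    refine hout x hx (hE.saturated ⟨x, y⟩ ⟨x, y₀⟩ (sameColumn_of_mem_Ioo hj hx hx) ?_ h)
    intro t ht
    exact hcolZ x hx t (Set.ordConnected_Ioo.uIcc_subset hy ⟨hay, hyb⟩ ht)
  have hlineE : ∀ y ∈ Set.Ioo α β, (⟨k, y⟩ : ℂ) ∉ E := by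
    intro y hy h
    refine hz (hE.saturated ⟨k, y⟩ ⟨k, y₀⟩ ⟨hk0, hk0, rfl, rfl⟩ ?_ h)
    intro t ht
    exact hJ t (Set.ordConnected_Ioo.uIcc_subset hy hy₀ ht)
  -- the rectangle crossing the grid line
  obtain ⟨θJ, hθJ, -, -, hθJr⟩ := exists_openEmbedding_Ioo hαy hyβ
  have hθJm : ∀ s, θJ s ∈ Set.Ioo α β := fun s => hθJr ▸ Set.mem_range_self s
  let ψ : ℝ × ℝ → ℂ := fun p => ⟨ξ p.1, θJ p.2⟩
  have hψ : IsOpenEmbedding ψ := isOpenEmbedding_mk hξ hθJ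
  have hψcases : ∀ p : ℝ × ℝ, 0 ≤ p.1 → ψ p ∉ E := by
    intro p hp
    rcases hp.eq_or_lt with h | h
    · have : ψ p = ⟨k, θJ p.2⟩ := by simp only [ψ, ← h, hξ0]
      rw [this]
      exact hlineE _ (hθJm _)
    · exact hcolE _ (hpos _ h) _ ⟨haα.trans_lt (hθJm p.2).1, (hθJm p.2).2.trans_le hβb⟩
  have hψZ : Set.range ψ ⊆ gridPart ω := by
    rintro _ ⟨p, rfl⟩
    rcases lt_trichotomy p.1 0 with h | h | h
    · exact hE.subset (hin _ (hneg _ h) _ (hθJm _))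
    · have : ψ p = ⟨k, θJ p.2⟩ := by simp only [ψ, h, hξ0]
      rw [this]
      exact hJ _ (hθJm _)
    · exact hkj _ (hpos _ h) _ (hJ _ (hθJm _))
  have hP₁ : Pushable ω X₀ (E ∪ Set.range ψ) := by
    refine hE.pushable.attach hE.isOpen hψ (hψZ.trans (gridPart_subset ω))
      (fun p hp => hin _ (hneg _ hp) _ (hθJm _)) ?_ ?_
    · intro p p' _ h1 h
      have hp : p.1 < 0 := by
        by_contra hc
        exact hψcases p (not_lt.1 hc) h
      exact hin _ (hneg _ (h1.trans_lt hp)) _ (hθJm _)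
    · intro p p' h2 h1 h
      have hp : p.1 < 0 := by
        by_contra hc
        exact hψcases p (not_lt.1 hc) (hE.base h)
      refine hX _ _ (sameColumn_of_mem_Ioo hi (hneg _ hp) (hneg _ (h1.trans_lt hp))) ?_ h
      intro t ht
      have ht' : t = θJ p.2 := by
        simpa [ψ, h2] using ht
      rw [ht']
      exact hE.subset (hin _ (hneg _ hp) _ (hθJm _))
  have ho₁ : IsOpen (E ∪ Set.range ψ) := hE.isOpen.union hψ.isOpen_range
  have hmem₁ : ∀ x ∈ Set.Ioo (j : ℝ) (j + 1), ∀ y ∈ Set.Ioo α β, (⟨x, y⟩ : ℂ) ∈ E ∪ Set.range ψ := by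
    intro x hx y hy
    obtain ⟨s, -, hs⟩ := hsurj hx
    rw [← hθJr] at hy
    obtain ⟨t, rfl⟩ := hy
    exact Or.inr ⟨(s, t), by simp only [ψ, hs]⟩
  have hmem₁' : ∀ x ∈ Set.Ioo (j : ℝ) (j + 1), ∀ y ∈ Set.Ioo a b,
      (⟨x, y⟩ : ℂ) ∈ E ∪ Set.range ψ → y ∈ Set.Ioo α β := by
    rintro x hx y hy (h | ⟨p, hp⟩)
    · exact absurd h (hcolE x hx y hy)
    · have : θJ p.2 = y := congrArg Complex.im hp
      exact this ▸ hθJm _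
  -- the upper part of the column
  obtain ⟨θ₂, hθ₂, hθ₂m, hθ₂0, hθ₂r⟩ := exists_openEmbedding_Ioo hαy hyb
  have hθ₂mem : ∀ s, θ₂ s ∈ Set.Ioo α b := fun s => hθ₂r ▸ Set.mem_range_self s
  have hθ₂mem' : ∀ s, θ₂ s ∈ Set.Ioo a b := fun s =>
    ⟨haα.trans_lt (hθ₂mem s).1, (hθ₂mem s).2⟩
  obtain ⟨hP₂, ho₂⟩ := hP₁.attach_column ho₁ j hθ₂
    (fun x hx t => gridPart_subset ω (hcolZ x hx _ (hθ₂mem' t)))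
    (fun x hx t ht => hmem₁ x hx _ ⟨(hθ₂mem t).1, (hθ₂0 ▸ hθ₂m ht).trans hyβ⟩)
    (fun x hx t t' htt h => hmem₁ x hx _ ⟨(hθ₂mem t').1,
      (hθ₂m.monotone htt).trans_lt (hmem₁' x hx _ (hθ₂mem' t) h).2⟩)
    (fun x hx t h => hcolE x hx _ (hθ₂mem' t) (hE.base h))
  rw [hθ₂r] at hP₂ ho₂
  set C₂ : Set ℂ := {w | w.re ∈ Set.Ioo (j : ℝ) (j + 1) ∧ w.im ∈ Set.Ioo α b} with hC₂
  have hmem₂' : ∀ x ∈ Set.Ioo (j : ℝ) (j + 1), ∀ y ∈ Set.Ioo a b,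
      (⟨x, y⟩ : ℂ) ∈ E ∪ Set.range ψ ∪ C₂ → y ∈ Set.Ioo α b := by
    rintro x hx y hy (h | h)
    · exact ⟨(hmem₁' x hx y hy h).1, hy.2⟩
    · exact h.2
  -- the whole column
  obtain ⟨θ₃, hθ₃, hθ₃m, hθ₃0, hθ₃r⟩ := exists_openEmbedding_Ioo hay hyb
  have hθ₃mem : ∀ s, θ₃ s ∈ Set.Ioo a b := fun s => hθ₃r ▸ Set.mem_range_self s
  have hη : IsOpenEmbedding (θ₃ ∘ Neg.neg) := hθ₃.comp (Homeomorph.neg ℝ).isOpenEmbedding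
  have hηr : Set.range (θ₃ ∘ Neg.neg) = Set.Ioo a b := by
    rw [← hθ₃r]; exact neg_surjective.range_comp θ₃
  obtain ⟨hP₃, ho₃⟩ := hP₂.attach_column ho₂ j hη
    (fun x hx t => gridPart_subset ω (hcolZ x hx _ (hθ₃mem _)))
    (fun x hx t ht => Or.inr ⟨hx, hαy.trans (hθ₃0 ▸ hθ₃m (neg_pos.2 ht)), (hθ₃mem _).2⟩)
    (fun x hx t t' htt h => Or.inr ⟨hx,
      (hmem₂' x hx _ (hθ₃mem _) h).1.trans_le (hθ₃m.monotone (neg_le_neg htt)), (hθ₃mem _).2⟩)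
    (fun x hx t h => hcolE x hx _ (hθ₃mem _) (hE.base h))
  rw [hηr] at hP₃ ho₃
  set C₃ : Set ℂ := {w | w.re ∈ Set.Ioo (j : ℝ) (j + 1) ∧ w.im ∈ Set.Ioo a b} with hC₃
  have hC₂₃ : C₂ ⊆ C₃ := fun w hw => ⟨hw.1, haα.trans_lt hw.2.1, hw.2.2⟩
  have hEq : E ∪ Set.range ψ ∪ C₂ ∪ C₃ = E ∪ Set.range ψ ∪ C₃ := by
    rw [Set.union_assoc, Set.union_eq_self_of_subset_left hC₂₃]
  rw [hEq] at hP₃ ho₃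
  have hC₃c : IsPreconnected C₃ := by
    have := (isPreconnected_Ioo (a := (j : ℝ)) (b := j + 1)).prod
      (isPreconnected_Ioo (a := a) (b := b))
    convert this.image (fun q : ℝ × ℝ => (⟨q.1, q.2⟩ : ℂ))
      (continuous_mk_complex continuous_fst continuous_snd).continuousOn
    ext u
    constructor
    · exact fun hu => ⟨(u.re, u.im), hu, rfl⟩
    · rintro ⟨q, hq, rfl⟩
      exact hq
  refine ⟨E ∪ Set.range ψ ∪ C₃, ⟨ho₃, fun w hw => Or.inl (Or.inl (hE.base hw)), ?_, ?_, ?_, hP₃⟩,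
    fun w hw => Or.inl (Or.inl hw), ?_⟩
  · refine Set.union_subset (Set.union_subset hE.subset hψZ) fun w hw => ?_
    exact hcolZ w.re hw.1 w.im hw.2
  · refine IsPreconnected.union ⟨xo, y₀⟩ (hmem₁ xo hxom y₀ hy₀) ⟨hxom, hay, hyb⟩ ?_ hC₃c
    refine hE.preconnected.union (ψ (-1, 0)) (hin _ (hneg _ (by norm_num)) _ (hθJm _))
      (Set.mem_range_self _) (isPreconnected_range hψ.continuous)
  · intro w w' hc hseg hw
    have hcol : w.re ∈ Set.Ioo (j : ℝ) (j + 1) → w.im ∈ Set.Ioo a b → w' ∈ C₃ := by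
      intro h1 h2
      refine ⟨hc.mem_Ioo hj h1, mem_Ioo_of_uIcc_subset (U := U) h2 haU hbU fun t ht => ?_⟩
      exact (sameColumn_of_mem_Ioo hj h1 hxom).mk_mem (hseg t ht)
    rcases hw with (hw | ⟨p, rfl⟩) | hw
    · exact Or.inl (Or.inl (hE.saturated w w' hc hseg hw))
    · rcases lt_trichotomy p.1 0 with h | h | h
      · exact Or.inl (Or.inl (hE.saturated _ w' hc hseg (hin _ (hneg _ h) _ (hθJm _))))
      · have hre : (ψ p).re = k := by simp only [ψ, h, hξ0]
        rw [hre] at hc hseg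
        have hw're := hc.eq_intCast hk
        have hw'im : w'.im ∈ Set.Ioo α β :=
          mem_Ioo_of_uIcc_subset (U := {y | (⟨k, y⟩ : ℂ) ∈ gridPart ω}) (hθJm p.2) hα hβ hseg
        rw [← hθJr] at hw'im
        obtain ⟨t, ht⟩ := hw'im
        exact Or.inl (Or.inr ⟨(0, t), Complex.ext (hξ0.trans hw're.symm) ht⟩)
      · exact Or.inr (hcol (hpos _ h)
          ⟨haα.trans_lt (hθJm p.2).1, (hθJm p.2).2.trans_le hβb⟩)
    · exact Or.inr (hcol hw.1 hw.2)
  · rw [← hθJr] at hy₀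
    obtain ⟨t, ht⟩ := hy₀
    exact Or.inl (Or.inr ⟨(0, t), Complex.ext hξ0 ht⟩)

theorem exists_column_coordinate (k : ℤ) :
    ∃ ξ : ℝ → ℝ, IsOpenEmbedding ξ ∧ ξ 0 = k ∧
      (∀ s < 0, ξ s ∈ Set.Ioo ((k - 1 : ℤ) : ℝ) ((k - 1 : ℤ) + 1)) ∧
      (∀ s > 0, ξ s ∈ Set.Ioo (k : ℝ) (k + 1)) ∧
      Set.Ioo (k : ℝ) (k + 1) ⊆ ξ '' Set.Ioi 0 ∧
      Set.Ioo ((k - 1 : ℤ) : ℝ) ((k - 1 : ℤ) + 1) ⊆ ξ '' Set.Iio 0 := by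
  obtain ⟨ξ, h, hm, h0, hr⟩ := exists_openEmbedding_Ioo (a := (k : ℝ) - 1) (e := k) (b := k + 1)
    (by linarith) (by linarith)
  have hmem : ∀ s, ξ s ∈ Set.Ioo ((k : ℝ) - 1) (k + 1) := fun s => hr ▸ Set.mem_range_self s
  refine ⟨ξ, h, h0, fun s hs => ?_, fun s hs => ?_, fun x hx => ?_, fun x hx => ?_⟩
  · push_cast
    refine ⟨(hmem s).1, ?_⟩
    have := hm hs
    linarith
  · refine ⟨?_, (hmem s).2⟩
    have := hm hs
    linarith
  · obtain ⟨s, rfl⟩ : x ∈ Set.range ξ := by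
      rw [hr]; exact ⟨by linarith [hx.1], hx.2⟩
    exact ⟨s, hm.lt_iff_lt.1 (by rw [h0]; exact hx.1), rfl⟩
  · push_cast at hx
    obtain ⟨s, rfl⟩ : x ∈ Set.range ξ := by
      rw [hr]; exact ⟨hx.1, by linarith [hx.2]⟩
    exact ⟨s, hm.lt_iff_lt.1 (by rw [h0]; linarith [hx.2]), rfl⟩

theorem Engulfed.sUnion {ω X₀ : Set ℂ} {c : Set (Set ℂ)} (hc : ∀ E ∈ c, Engulfed ω X₀ E)
    (hch : IsChain (· ⊆ ·) c) (hne : c.Nonempty) {p : ℂ} (hp : p ∈ X₀) :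
    Engulfed ω X₀ (⋃₀ c) := by
  obtain ⟨E₀, hE₀⟩ := hne
  refine ⟨isOpen_sUnion fun E hE => (hc E hE).isOpen,
    (hc E₀ hE₀).base.trans (Set.subset_sUnion_of_mem hE₀),
    Set.sUnion_subset fun E hE => (hc E hE).subset,
    _root_.isPreconnected_sUnion p c (fun E hE => (hc E hE).base hp)
      fun E hE => (hc E hE).preconnected, ?_, ?_⟩
  · rintro w w' h hseg ⟨E, hE, hw⟩
    exact ⟨E, hE, (hc E hE).saturated w w' h hseg hw⟩
  · intro L hL hLc
    have : Nonempty c := ⟨⟨E₀, hE₀⟩⟩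
    obtain ⟨⟨E, hE⟩, hLE⟩ := hL.elim_directed_cover (fun E : c => (E : Set ℂ))
      (fun E => (hc E E.2).isOpen) (by rwa [← Set.sUnion_eq_iUnion]) hch.directed
    exact (hc E hE).pushable L hL hLE

/-- Engulfing in a grid: a compact connected part of `gridPart ω` can be pushed into the component
of its leftmost portion. -/
theorem exists_engulfing {ω : Set ℂ} (ho : IsOpen ω) {c : ℝ} (hc : ∀ w ∈ ω, w.re < c)
    (hesc : ∀ q ∈ closure ω, q ∉ ω → ∃ q' : ℂ, c ≤ q'.re ∧ JoinedIn ωᶜ q' q)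
    {T : ℝ} (hT : 0 < T) (hper : ∀ w ∈ ω, w + T * Complex.I ∉ ω) (v : ℕ) {L : Set ℂ}
    (hL : IsCompact L) (hLc : IsPreconnected L) (hLZ : L ⊆ gridPart ω) (hLpos : ∀ w ∈ L, 0 < w.re)
    {p : ℂ} (hp : p ∈ L) (hpv : p.re < v) :
    ∃ h : ℂ ≃ₜ ℂ, SuppIn h ω ∧
      Set.MapsTo h L (connectedComponentIn (gridPart ω ∩ {w | w.re < v}) p) ∧
      Set.MapsTo h (connectedComponentIn (gridPart ω ∩ {w | w.re < v}) p)
        (connectedComponentIn (gridPart ω ∩ {w | w.re < v}) p) := by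
  set X₀ := connectedComponentIn (gridPart ω ∩ {w | w.re < v}) p with hX₀
  have hZo := isOpen_gridPart ho
  have hpX : p ∈ X₀ := mem_connectedComponentIn ⟨hLZ hp, hpv⟩
  have hXs : Saturated ω X₀ := saturated_connectedComponentIn v p
  have hbase : Engulfed ω X₀ X₀ := by
    refine ⟨?_, subset_rfl, (connectedComponentIn_subset _ _).trans Set.inter_subset_left,
      isPreconnected_connectedComponentIn, hXs, fun K hK hKX => ⟨Homeomorph.refl ℂ, SuppIn.refl _,
        fun x hx => hKX hx, fun x hx => hx⟩⟩
    exact (hZo.inter (isOpen_lt Complex.continuous_re continuous_const)).connectedComponentIn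
  obtain ⟨E, -, hmax⟩ := zorn_subset_nonempty {E | Engulfed ω X₀ E}
    (fun c hc hch hne => ⟨⋃₀ c, Engulfed.sUnion (fun E hE => hc hE) hch hne hpX,
      fun s hs => Set.subset_sUnion_of_mem hs⟩) X₀ hbase
  have hE : Engulfed ω X₀ E := hmax.prop
  suffices hLE : L ⊆ E from hE.pushable L hL hLE
  refine hLc.subset_of_closure_inter_subset hE.isOpen ⟨p, hp, hE.base hpX⟩ ?_
  rintro z ⟨hzcl, hzL⟩
  by_contra hzE
  have hzZ := hLZ hzL
  have hzpos := hLpos z hzL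
  -- the maximal vertical interval through `z`
  let U : Set ℝ := {y | (⟨z.re, y⟩ : ℂ) ∈ gridPart ω}
  have hU : IsOpen U := hZo.preimage (continuous_mk_complex continuous_const continuous_id)
  have hzU : z.im ∈ U := hzZ
  have hup : z.im + T ∉ U := by
    intro h
    refine hper _ (gridPart_subset ω hzU) ?_
    convert gridPart_subset ω h using 1
    apply Complex.ext <;> simp
  have hdn : z.im - T ∉ U := by
    intro h
    refine hper _ (gridPart_subset ω h) ?_
    convert gridPart_subset ω hzU using 1
    apply Complex.ext <;> simp
  obtain ⟨α, β, hαz, hzβ, hJ, hα, hβ⟩ :=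
    exists_maximal_Ioo hU hzU (by linarith) hdn (by linarith) hup
  have hsegJ : ∀ y ∈ Set.Ioo α β, ∀ t ∈ Set.uIcc y z.im, t ∈ U := fun y hy t ht =>
    hJ (Set.ordConnected_Ioo.uIcc_subset hy ⟨hαz, hzβ⟩ ht)
  have hline : ∀ y ∈ Set.Ioo α β, (⟨z.re, y⟩ : ℂ) ∉ E := fun y hy h =>
    hzE (hE.saturated ⟨z.re, y⟩ z ⟨hzpos, hzpos, rfl, rfl⟩ (hsegJ y hy) h)
  have hnear : ∀ N ∈ 𝓝 z.re, ∃ x ∈ N, ∃ y ∈ Set.Ioo α β, (⟨x, y⟩ : ℂ) ∈ E := by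
    intro N hN
    have h1 : ∀ᶠ w : ℂ in 𝓝 z, w.re ∈ N := Complex.continuous_re.continuousAt.eventually hN
    have h2 : ∀ᶠ w : ℂ in 𝓝 z, w.im ∈ Set.Ioo α β :=
      Complex.continuous_im.continuousAt.eventually (Ioo_mem_nhds hαz hzβ)
    obtain ⟨w, ⟨hw1, hw2⟩, hwE⟩ := mem_closure_iff_nhds.1 hzcl _ (h1.and h2)
    exact ⟨w.re, hw1, w.im, hw2, hwE⟩
  by_cases hint : ∃ k : ℤ, z.re = k
  swap
  · have hfl : z.re ∈ Set.Ioo (⌊z.re⌋ : ℝ) (⌊z.re⌋ + 1) :=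
      ⟨lt_of_le_of_ne (Int.floor_le _) fun h => hint ⟨_, h.symm⟩, Int.lt_floor_add_one _⟩
    have hfl0 : 0 ≤ ⌊z.re⌋ := Int.floor_nonneg.2 hzpos.le
    obtain ⟨x, hx, y, hy, hxy⟩ := hnear _ (Ioo_mem_nhds hfl.1 hfl.2)
    refine hzE (hE.saturated ⟨x, y⟩ z (sameColumn_of_mem_Ioo hfl0 hx hfl) ?_ hxy)
    intro t ht
    exact (sameColumn_of_mem_Ioo hfl0 hfl hx).mk_mem (hsegJ y hy t ht)
  obtain ⟨k, hzk⟩ := hint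
  have hk : 1 ≤ k := by
    rw [hzk] at hzpos
    have : 0 < k := by exact_mod_cast hzpos
    omega
  obtain ⟨hklo, hkhi⟩ := grid_intCast hk
  have hz' : (⟨k, z.im⟩ : ℂ) = z := Complex.ext hzk.symm rfl
  have hJ' : ∀ y ∈ Set.Ioo α β, (⟨k, y⟩ : ℂ) ∈ gridPart ω := fun y hy => hzk ▸ hJ hy
  have hα' : (⟨k, α⟩ : ℂ) ∉ gridPart ω := fun h => hα (show (⟨z.re, α⟩ : ℂ) ∈ _ from hzk ▸ h)
  have hβ' : (⟨k, β⟩ : ℂ) ∉ gridPart ω := fun h => hβ (show (⟨z.re, β⟩ : ℂ) ∈ _ from hzk ▸ h)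
  have hside : ∀ j : ℤ, k ≤ j + 1 → j ≤ k → ∀ x ∈ Set.Ioo (j : ℝ) (j + 1), ∀ y ∈ Set.Ioo α β,
      (⟨x, y⟩ : ℂ) ∈ E → ∀ x' ∈ Set.Ioo (j : ℝ) (j + 1), ∀ y' ∈ Set.Ioo α β,
      (⟨x', y'⟩ : ℂ) ∈ E := by
    intro j h1 h2 x hx y hy hxy x' hx' y' hy'
    have hj : 0 ≤ j := by omega
    refine hE.saturated ⟨x, y⟩ ⟨x', y'⟩ (sameColumn_of_mem_Ioo hj hx hx') ?_ hxy
    intro t ht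
    obtain ⟨h3, h4⟩ := grid_of_mem_Ioo hj hx.1 hx.2
    have h1' : (k : ℝ) ≤ j + 1 := by exact_mod_cast h1
    have h2' : (j : ℝ) ≤ k := by exact_mod_cast h2
    refine mem_gridPart_of_grid_le (hJ' t (Set.ordConnected_Ioo.uIcc_subset hy hy' ht))
      (by rw [h3, hklo]; linarith) (by rw [h4, hkhi]; linarith)
  have hfinal : ∀ E', Engulfed ω X₀ E' → E ⊆ E' → (⟨k, z.im⟩ : ℂ) ∉ E' := by
    intro E' hE' hEE' hzE'
    exact hzE (hmax.2 hE' hEE' (hz' ▸ hzE'))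
  obtain ⟨ξ, hξ, hξ0, hξn, hξp, hξs, hξs'⟩ := exists_column_coordinate k
  by_cases hR : ∀ x ∈ Set.Ioo (k : ℝ) (k + 1), ∀ y ∈ Set.Ioo α β, (⟨x, y⟩ : ℂ) ∈ E
  · by_cases hLf : ∀ x ∈ Set.Ioo ((k - 1 : ℤ) : ℝ) ((k - 1 : ℤ) + 1), ∀ y ∈ Set.Ioo α β,
        (⟨x, y⟩ : ℂ) ∈ E
    · have hαβ : α < β := hαz.trans hzβ
      have hclos : ∀ y ∈ Set.Icc α β, (⟨k, y⟩ : ℂ) ∈ closure ω := by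
        intro y hy
        rw [← closure_Ioo hαβ.ne] at hy
        exact map_mem_closure (continuous_mk_complex continuous_const continuous_id) hy
          fun t ht => gridPart_subset ω (hJ' t ht)
      have hm : (α + β) / 2 ∈ Set.Ioo α β := ⟨by linarith, by linarith⟩
      have hnotE : ∀ y ∈ Set.Icc α β, (⟨k, y⟩ : ℂ) ∉ E := by
        intro y hy h
        rcases hy.1.eq_or_lt with h1 | h1
        · exact hα' (h1 ▸ hE.subset h)
        rcases hy.2.eq_or_lt with h2 | h2
        · exact hβ' (h2 ▸ hE.subset h)
        exact hline y ⟨h1, h2⟩ (hzk ▸ h)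
      refine false_of_hasLog (E := E) (Z := gridPart ω) (m := ⟨k, (α + β) / 2⟩)
        (s := (β - α) / 2) (by linarith) hE.preconnected hE.subset (hJ' _ hm) ?_ ?_ ?_ ?_
      · convert hasLog_gridPart ho hc hesc hk hβ' (hclos β ⟨hαβ.le, le_rfl⟩) using 1
        apply Complex.ext
        · simp
        · simp; ring
      · convert hasLog_gridPart ho hc hesc hk hα' (hclos α ⟨le_rfl, hαβ.le⟩) using 1
        apply Complex.ext
        · simp
        · simp; ring
      · intro y hy
        have : (⟨k, (α + β) / 2⟩ : ℂ) + y * Complex.I = ⟨k, (α + β) / 2 + y⟩ := by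
          apply Complex.ext <;> simp
        rw [this]
        exact hnotE _ ⟨by linarith [hy.1], by linarith [hy.2]⟩
      · filter_upwards [Ioo_mem_nhdsGT (zero_lt_one' ℝ)] with ε hε
        have e1 : (⟨k, (α + β) / 2⟩ : ℂ) + ε = ⟨k + ε, (α + β) / 2⟩ := by
          apply Complex.ext <;> simp
        have e2 : (⟨k, (α + β) / 2⟩ : ℂ) - ε = ⟨k - ε, (α + β) / 2⟩ := by
          apply Complex.ext <;> simp
        rw [e1, e2]
        refine ⟨hR _ ⟨by linarith [hε.1], by linarith [hε.2]⟩ _ hm, hLf _ ?_ _ hm⟩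
        push_cast
        exact ⟨by linarith [hε.2], by linarith [hε.1]⟩
    · have hout : ∀ x ∈ Set.Ioo ((k - 1 : ℤ) : ℝ) ((k - 1 : ℤ) + 1), (⟨x, z.im⟩ : ℂ) ∉ E :=
        fun x hx h => hLf (hside (k - 1) (by omega) (by omega) x hx _ ⟨hαz, hzβ⟩ h)
      obtain ⟨E', h1, h2, h3⟩ := hE.exists_attach hXs (k := k) (i := k) (j := k - 1) hk (by omega)
        (by omega) (by omega) (by omega) (hξ.comp (Homeomorph.neg ℝ).isOpenEmbedding)
        (by simpa using hξ0) (fun s hs => hξp _ (neg_pos.2 hs)) (fun s hs => hξn _ (neg_neg_iff_pos.2 hs))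
        (fun x hx => by
          obtain ⟨s, hs, rfl⟩ := hξs' hx
          exact ⟨-s, by simpa using hs, by simp⟩)
        hαz hzβ hJ' hα' hβ' hR hout (hz'.symm ▸ hzE) hT hper ho
      exact hfinal E' h1 h2 h3
  · have hout : ∀ x ∈ Set.Ioo (k : ℝ) (k + 1), (⟨x, z.im⟩ : ℂ) ∉ E :=
      fun x hx h => hR (hside k (by omega) le_rfl x hx _ ⟨hαz, hzβ⟩ h)
    have hLf : ∀ x ∈ Set.Ioo ((k - 1 : ℤ) : ℝ) ((k - 1 : ℤ) + 1), ∀ y ∈ Set.Ioo α β,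
        (⟨x, y⟩ : ℂ) ∈ E := by
      obtain ⟨x, hx, y, hy, hxy⟩ := hnear (Set.Ioo ((k : ℝ) - 1) (k + 1))
        (Ioo_mem_nhds (by linarith) (by linarith))
      rcases lt_trichotomy x k with h | h | h
      · exact hside (k - 1) (by omega) (by omega) x (by push_cast; exact ⟨hx.1, by linarith⟩) y hy hxy
      · exact absurd hxy (by rw [h, ← hzk]; exact hline y hy)
      · exact absurd (hside k (by omega) le_rfl x ⟨h, hx.2⟩ y hy hxy) hR
    obtain ⟨E', h1, h2, h3⟩ := hE.exists_attach hXs (k := k) (i := k - 1) (j := k) hk (by omega)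
      (by omega) (by omega) le_rfl hξ hξ0 hξn hξp hξs hαz hzβ hJ' hα' hβ' hLf hout
      (hz'.symm ▸ hzE) hT hper ho
    exact hfinal E' h1 h2 h3

/-- A curve in `ω` whose real part tends to `-∞` can be pushed to the left of any vertical line. -/
theorem exists_push_tail {ω : Set ℂ} (ho : IsOpen ω) {c : ℝ} (hc : ∀ w ∈ ω, w.re < c)
    (hesc : ∀ q ∈ closure ω, q ∉ ω → ∃ q' : ℂ, c ≤ q'.re ∧ JoinedIn ωᶜ q' q)
    {T : ℝ} (hT : 0 < T) (hper : ∀ w ∈ ω, w + T * Complex.I ∉ ω) {μ : ℝ → ℂ}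
    (hμ : ContinuousOn μ (Set.Ico 0 1)) (hμω : ∀ t ∈ Set.Ico (0 : ℝ) 1, μ t ∈ ω)
    (hμlim : ∀ M : ℝ, ∃ e ∈ Set.Ico (0 : ℝ) 1, ∀ t ∈ Set.Ico e 1, (μ t).re < M) (ρ : ℝ) :
    ∃ h : ℂ ≃ₜ ℂ, SuppIn h ω ∧ ∀ t ∈ Set.Ico (0 : ℝ) 1, (h (μ t)).re < ρ := by
  obtain ⟨e, he, heρ⟩ := hμlim ρ
  have hsub : ∀ s ∈ Set.Ico (0 : ℝ) 1, Set.Icc 0 s ⊆ Set.Ico (0 : ℝ) 1 := fun s hs t ht =>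
    ⟨ht.1, ht.2.trans_lt hs.2⟩
  have hcomp : ∀ s ∈ Set.Ico (0 : ℝ) 1, IsCompact (μ '' Set.Icc 0 s) := fun s hs =>
    isCompact_Icc.image_of_continuousOn (hμ.mono (hsub s hs))
  obtain ⟨x₀, hx₀ρ, hx₀⟩ : ∃ x₀ < ρ, ∀ t ∈ Set.Icc 0 e, x₀ < (μ t).re := by
    obtain ⟨m, hm⟩ := ((hcomp e he).image Complex.continuous_re).bddBelow
    refine ⟨min (m - 1) (ρ - 1), (min_le_right _ _).trans_lt (by linarith), fun t ht => ?_⟩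
    have := hm ⟨μ t, ⟨t, ht, rfl⟩, rfl⟩
    exact (min_le_left _ _).trans_lt (by linarith)
  obtain ⟨e', he', he'x⟩ := hμlim x₀
  obtain ⟨δ₀, hδ₀, hthick⟩ := (hcomp e' he').exists_cthickening_subset_open ho
    (Set.image_subset_iff.2 fun t ht => hμω t (hsub e' he' ht))
  obtain ⟨v, hv⟩ := exists_nat_gt ((ρ - x₀) / δ₀)
  have hv0 : (0 : ℝ) < v := lt_of_le_of_lt (by have : 0 < ρ - x₀ := sub_pos.2 hx₀ρ; positivity) hv
  set δ : ℝ := (ρ - x₀) / v with hδ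
  have hδpos : 0 < δ := div_pos (sub_pos.2 hx₀ρ) hv0
  have hδδ₀ : δ ≤ δ₀ := by
    rw [hδ, div_le_iff₀ hv0]
    rw [div_lt_iff₀ hδ₀] at hv
    linarith
  have hδv : δ * v = ρ - x₀ := by rw [hδ]; field_simp
  have hδc : (δ : ℂ) ≠ 0 := by exact_mod_cast hδpos.ne'
  let B : ℂ ≃ₜ ℂ := (Homeomorph.mulLeft₀ (δ : ℂ) hδc).trans (Homeomorph.addRight (x₀ : ℂ))
  have hB : ∀ w, B w = δ * w + x₀ := fun w => rfl
  have hBre : ∀ w, (B w).re = δ * w.re + x₀ := fun w => by simp [hB]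
  have hBim : ∀ w, (B w).im = δ * w.im := fun w => by simp [hB]
  have hAre : ∀ w, (B.symm w).re = (w.re - x₀) / δ := fun w => by
    have := hBre (B.symm w)
    rw [B.apply_symm_apply] at this
    rw [this]; field_simp; ring
  let ω' : Set ℂ := B ⁻¹' ω
  have ho' : IsOpen ω' := ho.preimage B.continuous
  let ν : ℝ → ℂ := fun t => B.symm (μ t)
  have hBν : ∀ t, B (ν t) = μ t := fun t => B.apply_symm_apply _
  have hν : ContinuousOn ν (Set.Ico 0 1) := B.symm.continuous.comp_continuousOn hμ
  have hνre : ∀ t, δ * (ν t).re + x₀ = (μ t).re := fun t => by rw [← hBre, hBν]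
  have hνgrid : ∀ t ∈ Set.Ico (0 : ℝ) 1, ν t ∈ gridPart ω' := by
    intro t ht x hx
    rcases le_or_gt t e' with hte | hte
    · refine hthick (Metric.mem_cthickening_of_dist_le _ (μ t) _ _ ⟨t, ⟨ht.1, hte⟩, rfl⟩ ?_)
      have hx1 : |x - (ν t).re| ≤ 1 := by
        rw [abs_le]
        exact ⟨by linarith [hx.1, le_gridLo (ν t).re], by linarith [hx.2, gridHi_le (ν t).re]⟩
      have : B ⟨x, (ν t).im⟩ - μ t = ((δ * (x - (ν t).re) : ℝ) : ℂ) := by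
        rw [← hBν]
        apply Complex.ext
        · rw [Complex.sub_re, hBre, hBre, Complex.ofReal_re]; ring
        · rw [Complex.sub_im, hBim, hBim, Complex.ofReal_im]; ring
      rw [dist_eq_norm, this, Complex.norm_real, Real.norm_eq_abs, abs_mul, abs_of_pos hδpos]
      calc δ * |x - (ν t).re| ≤ δ * 1 := by gcongr
        _ ≤ δ₀ := by linarith
    · have hneg : (ν t).re < 0 := by
        have := he'x t ⟨hte.le, ht.2⟩
        have h2 := hνre t
        by_contra hcon
        have := mul_nonneg hδpos.le (not_lt.1 hcon)
        linarith
      unfold gridLo gridHi at hx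
      rw [if_pos hneg.le, if_pos hneg] at hx
      have : x = (ν t).re := le_antisymm hx.2 hx.1
      rw [this]
      change B (ν t) ∈ ω
      rw [hBν]
      exact hμω t ht
  have heIco : ∀ t ∈ Set.Ico e 1, t ∈ Set.Ico (0 : ℝ) 1 := fun t ht => ⟨he.1.trans ht.1, ht.2⟩
  have hνlt : ∀ t ∈ Set.Ico e 1, (ν t).re < v := by
    intro t ht
    have h1 := heρ t ht
    have h2 := hνre t
    have h3 : δ * (ν t).re < δ * v := by rw [hδv]; linarith
    exact lt_of_mul_lt_mul_left h3 hδpos.le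
  have hee : e ∈ Set.Ico e 1 := ⟨le_rfl, he.2⟩
  obtain ⟨h, hsupp, hL, hX⟩ := exists_engulfing (ω := ω') ho' (c := (c - x₀) / δ)
    (fun w hw => by
      have := hc _ hw
      rw [hBre] at this
      rw [lt_div_iff₀ hδpos]; linarith)
    (fun q hq hqω => by
      have hq' : B q ∈ closure ω := by
        have := B.preimage_closure ω
        rw [← this] at hq
        exact hq
      obtain ⟨q', hq'c, hj⟩ := hesc _ hq' hqω
      refine ⟨B.symm q', ?_, ?_⟩
      · rw [hAre]; gcongr
      · have := hj.map_continuousOn (f := B.symm) B.symm.continuous.continuousOn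
        rw [B.symm_apply_apply] at this
        refine this.mono ?_
        rintro _ ⟨u, hu, rfl⟩
        change B (B.symm u) ∉ ω
        rwa [B.apply_symm_apply])
    (T := T / δ) (by positivity)
    (fun w hw hw' => by
      refine hper _ hw ?_
      have : B (w + (T / δ : ℝ) * Complex.I) = B w + T * Complex.I := by
        rw [hB, hB]; push_cast; field_simp; ring
      rw [← this]; exact hw')
    v (L := ν '' Set.Icc 0 e) (isCompact_Icc.image_of_continuousOn (hν.mono (hsub e he)))
    (isPreconnected_Icc.image _ (hν.mono (hsub e he)))
    (by
      rintro _ ⟨t, ht, rfl⟩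
      exact hνgrid t (hsub e he ht))
    (by
      rintro _ ⟨t, ht, rfl⟩
      have h1 := hx₀ t ht
      have h2 := hνre t
      by_contra hcon
      have := mul_nonpos_of_nonneg_of_nonpos hδpos.le (not_lt.1 hcon)
      linarith)
    (p := ν e) ⟨e, ⟨he.1, le_rfl⟩, rfl⟩ (hνlt e hee)
  have htail : ∀ t ∈ Set.Ico e 1,
      ν t ∈ connectedComponentIn (gridPart ω' ∩ {w | w.re < v}) (ν e) := by
    intro t ht
    have hpre : IsPreconnected (ν '' Set.Ico e 1) :=
      isPreconnected_Ico.image _ (hν.mono heIco)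
    refine hpre.subset_connectedComponentIn ⟨e, hee, rfl⟩ ?_ ⟨t, ht, rfl⟩
    rintro _ ⟨s, hs, rfl⟩
    exact ⟨hνgrid s (heIco s hs), hνlt s hs⟩
  have hres : ∀ t ∈ Set.Ico (0 : ℝ) 1, (h (ν t)).re < v := by
    intro t ht
    rcases le_or_gt t e with hte | hte
    · exact (connectedComponentIn_subset _ _ (hL ⟨t, ⟨ht.1, hte⟩, rfl⟩)).2
    · exact (connectedComponentIn_subset _ _ (hX (htail t ⟨hte.le, ht.2⟩))).2
  obtain ⟨G, hG, hGB⟩ := hsupp.extend B.isOpenEmbedding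
  refine ⟨G, hG.mono (Set.image_preimage_subset _ _), fun t ht => ?_⟩
  rw [← hBν, hGB, hBre]
  have := mul_lt_mul_of_pos_left (hres t ht) hδpos
  linarith

theorem SuppIn.exists_subtype {X : Type*} [TopologicalSpace X] {h : X ≃ₜ X} {Ω : Set X}
    (hh : SuppIn h Ω) : ∃ g : Ω ≃ₜ Ω, SuppIn g Set.univ ∧ ∀ x : Ω, (g x : X) = h x := by
  refine ⟨⟨⟨fun x => ⟨h x, hh.mem x.2⟩, fun x => ⟨h.symm x, hh.symm.mem x.2⟩,
    fun x => Subtype.ext (h.symm_apply_apply _), fun x => Subtype.ext (h.apply_symm_apply _)⟩,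
    by fun_prop, by fun_prop⟩, ?_, fun x => rfl⟩
  obtain ⟨C, hC, hCΩ, hid⟩ := hh
  refine ⟨Subtype.val ⁻¹' C, ?_, Set.subset_univ _, fun x hx => Subtype.ext (hid x hx)⟩
  rwa [Subtype.isCompact_iff, Subtype.image_preimage_coe, Set.inter_eq_right.2 hCΩ]

theorem exists_exp_lift {f : ℝ → ℂ} {a b : ℝ} (hab : a ≤ b) (hf : ContinuousOn f (Set.Icc a b))
    (hf0 : ∀ t ∈ Set.Icc a b, f t ≠ 0) {q : ℂ} (hq : Complex.exp q = f a) :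
    ∃ q', Complex.exp q' = f b ∧ JoinedIn (Complex.exp ⁻¹' (f '' Set.Icc a b)) q q' := by
  have hmem : ∀ t : unitInterval, a + t * (b - a) ∈ Set.Icc a b := fun t => by
    have h1 := t.2.1
    have h2 := t.2.2
    constructor <;> nlinarith
  let γ : C(unitInterval, {z : ℂ // z ≠ 0}) :=
    ⟨fun t => ⟨f (a + t * (b - a)), hf0 _ (hmem t)⟩,
      (hf.comp_continuous (by fun_prop) hmem).subtype_mk _⟩
  obtain ⟨Γ, hΓ, hΓ0⟩ := Complex.isCoveringMap_exp.exists_path_lifts γ q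
    (Subtype.ext (by simp [γ, hq]))
  have hexp : ∀ t, Complex.exp (Γ t) = f (a + t * (b - a)) := fun t =>
    congrArg Subtype.val (congrFun hΓ t)
  refine ⟨Γ 1, by simpa using hexp 1, ⟨⟨Γ, hΓ0, rfl⟩, fun t => ?_⟩⟩
  exact ⟨_, hmem t, (hexp t).symm⟩

/-- Let `f` be an arc from the centre to the boundary of the unit disc and let `l` be an arc in the
disc that meets `f` only in the centre, where it ends.  Then `l` can be shrunk towards the
centre by a homeomorphism that is supported in the disc minus `f`. -/
theorem exists_shrink_arc {f l : ℝ → ℂ} (hf : ContinuousOn f (Set.Icc 0 1)) (hf0 : f 0 = 0)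
    (hfne : ∀ t ∈ Set.Ioc (0 : ℝ) 1, f t ≠ 0) (hf1 : 1 ≤ ‖f 1‖) (hl : ContinuousOn l (Set.Icc 0 1))
    (hl1 : l 1 = 0) (hlball : ∀ t ∈ Set.Icc (0 : ℝ) 1, ‖l t‖ < 1)
    (hlf : ∀ t ∈ Set.Ico (0 : ℝ) 1, l t ∉ f '' Set.Icc 0 1) {r : ℝ} (hr : 0 < r) :
    ∃ h : ℂ ≃ₜ ℂ, SuppIn h (Metric.ball 0 1 \ f '' Set.Icc 0 1) ∧
      ∀ t ∈ Set.Ico (0 : ℝ) 1, ‖h (l t)‖ < r := by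
  set F := f '' Set.Icc 0 1 with hF
  set Ω : Set ℂ := Metric.ball 0 1 \ F with hΩ
  have hΩo : IsOpen Ω :=
    Metric.isOpen_ball.sdiff (isCompact_Icc.image_of_continuousOn hf).isClosed
  have hΩn : ∀ z ∈ Ω, ‖z‖ < 1 := fun z hz => mem_ball_zero_iff.1 hz.1
  have h0F : (0 : ℂ) ∈ F := ⟨0, by simp, hf0⟩
  obtain ⟨g, hg, hgexp⟩ : HasLog Ω 0 := by
    refine (hasLog_of_norm_lt hΩn hf1).of_joinedIn ?_
    have hpc : IsPathConnected F :=
      ((convex_Icc (0 : ℝ) 1).isPathConnected ⟨0, by simp⟩).image' hf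
    exact (hpc.joinedIn _ ⟨1, by simp, rfl⟩ _ h0F).mono fun z hz hzΩ => hzΩ.2 hz
  simp only [sub_zero] at hgexp
  let ω : Set ℂ := {w | Complex.exp w ∈ Ω ∧ g (Complex.exp w) = w}
  have hEo : IsOpen (Complex.exp ⁻¹' Ω) := hΩo.preimage Complex.continuous_exp
  have hgc : ContinuousOn (fun w => g (Complex.exp w)) (Complex.exp ⁻¹' Ω) :=
    hg.comp Complex.continuous_exp.continuousOn fun w hw => hw
  have ho : IsOpen ω := by
    rw [isOpen_iff_mem_nhds]
    rintro w ⟨hw, hgw⟩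
    have hcont : ContinuousAt (fun w => g (Complex.exp w) - w) w :=
      (hgc.continuousAt (hEo.mem_nhds hw)).sub continuousAt_id
    have hlim : Tendsto (fun w => ‖g (Complex.exp w) - w‖) (𝓝 w) (𝓝 0) := by
      have := hcont.norm.tendsto
      simpa only [hgw, sub_self, norm_zero] using this
    filter_upwards [hEo.mem_nhds hw, hlim.eventually (gt_mem_nhds Real.two_pi_pos)] with u hu hun
    refine ⟨hu, ?_⟩
    have hexp1 : Complex.exp (g (Complex.exp u) - u) = 1 := by
      rw [Complex.exp_sub, hgexp _ hu, div_self (Complex.exp_ne_zero _)]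
    obtain ⟨n, hn⟩ := Complex.exp_eq_one_iff.1 hexp1
    rw [hn] at hun
    have hn0 : n = 0 := by
      have h2 : ‖(n : ℂ) * (2 * Real.pi * Complex.I)‖ = |(n : ℝ)| * (2 * Real.pi) := by
        simp [abs_of_pos Real.pi_pos]
      rw [h2] at hun
      have h3 : |(n : ℝ)| < 1 := by
        by_contra hcon
        have := mul_le_mul_of_nonneg_right (not_lt.1 hcon) Real.two_pi_pos.le
        linarith
      have h4 : |n| < 1 := by exact_mod_cast h3
      exact Int.abs_lt_one_iff.1 h4
    rw [hn0] at hn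
    simpa [sub_eq_zero] using hn
  have hre : ∀ w ∈ ω, w.re < 0 := by
    rintro w ⟨hw, -⟩
    have := hΩn _ hw
    rwa [Complex.norm_exp, Real.exp_lt_one_iff] at this
  have hper : ∀ w ∈ ω, w + (2 * Real.pi : ℝ) * Complex.I ∉ ω := by
    rintro w ⟨hw, hgw⟩ ⟨-, hgw'⟩
    have : Complex.exp (w + (2 * Real.pi : ℝ) * Complex.I) = Complex.exp w := by
      have := Complex.exp_periodic w
      push_cast
      exact this
    rw [this, hgw] at hgw'
    have := congrArg Complex.im hgw'
    simp at this
  have hesc : ∀ q ∈ closure ω, q ∉ ω → ∃ q' : ℂ, (0 : ℝ) ≤ q'.re ∧ JoinedIn ωᶜ q' q := by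
    intro q hq hqω
    have hqΩ : Complex.exp q ∉ Ω := by
      intro hqΩ
      refine hqω ⟨hqΩ, ?_⟩
      have hc : ContinuousAt (fun w => g (Complex.exp w) - w) q :=
        (hgc.continuousAt (hEo.mem_nhds hqΩ)).sub continuousAt_id
      have hfr : ∃ᶠ w in 𝓝 q, w ∈ ω := mem_closure_iff_frequently.1 hq
      have hcl : (fun w => g (Complex.exp w) - w) q ∈ ({0} : Set ℂ) := by
        refine isClosed_singleton.mem_of_frequently_of_tendsto ?_ hc.tendsto
        exact hfr.mono fun w hw => by simp [hw.2]
      exact sub_eq_zero.1 hcl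
    by_cases hqn : Complex.exp q ∈ Metric.ball (0 : ℂ) 1
    · have hqF : Complex.exp q ∈ F := by
        by_contra hcon
        exact hqΩ ⟨hqn, hcon⟩
      obtain ⟨s, hs, hsq⟩ := hqF
      have hs0 : 0 < s := lt_of_le_of_ne hs.1 fun h => by
        rw [← h, hf0] at hsq
        exact Complex.exp_ne_zero _ hsq.symm
      have hsub : Set.Icc s 1 ⊆ Set.Icc (0 : ℝ) 1 := Set.Icc_subset_Icc_left hs.1
      obtain ⟨q', hq', hj⟩ := exists_exp_lift hs.2 (hf.mono hsub)
        (fun t ht => hfne t ⟨hs0.trans_le ht.1, ht.2⟩) hsq.symm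
      refine ⟨q', ?_, hj.symm.mono fun w hw hwω => hwω.1.2 (Set.image_mono hsub hw)⟩
      rw [← hq', Complex.norm_exp] at hf1
      exact Real.one_le_exp_iff.1 hf1
    · refine ⟨q, ?_, JoinedIn.refl hqω⟩
      rw [mem_ball_zero_iff, not_lt, Complex.norm_exp] at hqn
      exact Real.one_le_exp_iff.1 hqn
  have hlΩ : ∀ t ∈ Set.Ico (0 : ℝ) 1, l t ∈ Ω := fun t ht =>
    ⟨mem_ball_zero_iff.2 (hlball t ⟨ht.1, ht.2.le⟩), hlf t ht⟩
  have hgl : ∀ t ∈ Set.Ico (0 : ℝ) 1, Complex.exp (g (l t)) = l t := fun t ht => hgexp _ (hlΩ t ht)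
  have hgω : ∀ t ∈ Set.Ico (0 : ℝ) 1, g (l t) ∈ ω := fun t ht => by
    refine ⟨?_, ?_⟩ <;> rw [hgl t ht]
    exact hlΩ t ht
  obtain ⟨h, hh, hhr⟩ := exists_push_tail ho hre hesc Real.two_pi_pos hper (μ := fun t => g (l t))
    (hg.comp (hl.mono Set.Ico_subset_Icc_self) hlΩ) hgω
    (fun M => by
      have hc : Tendsto (fun t => ‖l t‖) (𝓝[Set.Icc 0 1] 1) (𝓝 0) := by
        have := (hl 1 (by simp)).norm.tendsto
        simpa only [hl1, norm_zero] using this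
      obtain ⟨ε, hε, hεM⟩ := Metric.mem_nhdsWithin_iff.1
        (hc.eventually (gt_mem_nhds (Real.exp_pos M)))
      refine ⟨max 0 (1 - ε / 2), ⟨le_max_left _ _, max_lt zero_lt_one (by linarith)⟩, ?_⟩
      intro t ht
      have ht0 : 0 ≤ t := (le_max_left _ _).trans ht.1
      have ht1 : 1 - ε / 2 ≤ t := (le_max_right _ _).trans ht.1
      have hb : t ∈ Metric.ball (1 : ℝ) ε ∩ Set.Icc 0 1 := by
        refine ⟨?_, ht0, ht.2.le⟩
        rw [Metric.mem_ball, Real.dist_eq, abs_lt]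
        exact ⟨by linarith, by linarith [ht.2]⟩
      have : ‖l t‖ < Real.exp M := hεM hb
      rwa [← hgl t ⟨ht0, ht.2⟩, Complex.norm_exp, Real.exp_lt_exp] at this)
    (Real.log r)
  obtain ⟨k, hk, hkh⟩ := hh.exists_subtype
  have hψ : IsOpenEmbedding fun w : ω => Complex.exp w := by
    refine IsOpenEmbedding.of_continuous_injective_isOpenMap
      (Complex.continuous_exp.comp continuous_subtype_val) ?_
      (Complex.isOpenMap_exp.comp ho.isOpenMap_subtype_val)
    intro w w' hww
    apply Subtype.ext
    have := congrArg g hww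
    simp only [w.2.2, w'.2.2] at this
    exact this
  obtain ⟨G, hG, hGψ⟩ := hk.extend hψ
  refine ⟨G, hG.mono ?_, fun t ht => ?_⟩
  · rintro _ ⟨w, -, rfl⟩
    exact w.2.1
  · have h1 := hGψ ⟨g (l t), hgω t ht⟩
    simp only [hgl t ht, hkh] at h1
    rw [h1, Complex.norm_exp, ← Real.lt_log_iff_exp_lt hr]
    exact hhr t ht

/-- Every connected compact set off `A` lies in an open disc off `A`. -/
def DiscCovered {T : Type*} [TopologicalSpace T] (A : Set T) : Prop :=
  ∀ K : Set T, IsCompact K → IsConnected K → Disjoint K A →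
    ∃ χ : ℂ → T, IsOpenEmbedding χ ∧ K ⊆ Set.range χ ∧ Disjoint (Set.range χ) A

section ArcRemoval

variable {T : Type*} [TopologicalSpace T] [T2Space T]

theorem DiscCovered.eventually_union_arc
    (hch : ∀ x : T, ∃ ψ : ℂ → T, IsOpenEmbedding ψ ∧ x ∈ Set.range ψ) {B : Set T}
    (hB : IsClosed B) {α : ℝ → T} (hα : ContinuousOn α (Set.Icc 0 1))
    (hinj : Set.InjOn α (Set.Icc 0 1)) (hαB : ∀ t ∈ Set.Ico (0 : ℝ) 1, α t ∉ B) {a : ℝ}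
    (ha : a ∈ Set.Ico (0 : ℝ) 1) (hcov : DiscCovered (B ∪ α '' Set.Icc a 1)) :
    ∃ c₀ ∈ Set.Ioc a 1, ∀ c ∈ Set.Ioc a c₀, DiscCovered (B ∪ α '' Set.Icc c 1) := by
  obtain ⟨ψ, hψ, p₀, hp₀⟩ := hch (α a)
  have hsub : Set.Icc a 1 ⊆ Set.Icc (0 : ℝ) 1 := Set.Icc_subset_Icc_left ha.1
  have hev : ∀ N ∈ 𝓝 (α a), ∃ w ∈ Set.Ioo a 1, ∀ t ∈ Set.Icc a w, α t ∈ N := by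
    intro N hN
    have h1 : ∀ᶠ t in 𝓝[≥] a, α t ∈ N := by
      have h2 : Tendsto α (𝓝[Set.Icc a 1] a) (𝓝 (α a)) := (hα.mono hsub) a ⟨le_rfl, ha.2.le⟩
      rw [nhdsWithin_Icc_eq_nhdsGE ha.2] at h2
      exact h2 hN
    obtain ⟨u, hu, huN⟩ := mem_nhdsGE_iff_exists_Icc_subset.1 h1
    refine ⟨min u ((a + 1) / 2), ⟨lt_min hu (by linarith [ha.2]),
      (min_le_right _ _).trans_lt (by linarith [ha.2])⟩, fun t ht => huN ⟨ht.1, ?_⟩⟩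
    exact ht.2.trans (min_le_left _ _)
  obtain ⟨w, hw, hwψ⟩ := hev (Set.range ψ) (hψ.isOpen_range.mem_nhds ⟨p₀, hp₀⟩)
  have hsubw : Set.Icc a w ⊆ Set.Icc (0 : ℝ) 1 := Set.Icc_subset_Icc ha.1 hw.2.le
  choose! β hβ using hwψ
  have hβc : ContinuousOn β (Set.Icc a w) := by
    rw [hψ.isInducing.continuousOn_iff]
    exact (hα.mono hsubw).congr hβ
  have hβinj : Set.InjOn β (Set.Icc a w) := by
    intro s hs t ht hst
    exact hinj (hsubw hs) (hsubw ht) (by rw [← hβ s hs, ← hβ t ht, hst])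
  have hβa : β a = p₀ := hψ.injective (by rw [hβ a ⟨le_rfl, hw.1.le⟩, hp₀])
  have hsub1 : Set.Icc w 1 ⊆ Set.Icc (0 : ℝ) 1 := Set.Icc_subset_Icc_left (ha.1.trans hw.1.le)
  have hfar : IsClosed (B ∪ α '' Set.Icc w 1) :=
    hB.union (isCompact_Icc.image_of_continuousOn (hα.mono hsub1)).isClosed
  have hp₀far : ψ p₀ ∉ B ∪ α '' Set.Icc w 1 := by
    rw [hp₀]
    rintro (h | ⟨t, ht, h⟩)
    · exact hαB a ha h
    · have := hinj (hsub1 ht) (hsub ⟨le_rfl, ha.2.le⟩) h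
      linarith [ht.1, hw.1]
  obtain ⟨ρ, hρ, hρfar⟩ := Metric.mem_nhds_iff.1
    ((hfar.isOpen_compl.preimage hψ.continuous).mem_nhds hp₀far)
  obtain ⟨c₀, hc₀, hc₀ρ⟩ := hev (ψ '' Metric.ball p₀ (ρ / 4))
    ((hψ.isOpenMap _ Metric.isOpen_ball).mem_nhds ⟨p₀, Metric.mem_ball_self (by positivity), hp₀⟩)
  refine ⟨min c₀ ((a + w) / 2), ⟨lt_min hc₀.1 (by linarith [hw.1]),
    (min_le_left _ _).trans hc₀.2.le⟩, fun c hc => ?_⟩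
  have hcw : c < w := (hc.2.trans (min_le_right _ _)).trans_lt (by linarith [hw.1])
  have hβρ : ∀ t ∈ Set.Icc a c, ‖β t - p₀‖ < ρ / 4 := by
    intro t ht
    obtain ⟨y, hy, hyt⟩ := hc₀ρ t ⟨ht.1, ht.2.trans (hc.2.trans (min_le_left _ _))⟩
    rw [← hβ t ⟨ht.1, ht.2.trans hcw.le⟩] at hyt
    rw [← hψ.injective hyt, ← dist_eq_norm]
    exact hy
  have hcm : c ∈ Set.Icc a w := ⟨hc.1.le, hcw.le⟩
  have hpρ := hβρ c ⟨hc.1.le, le_rfl⟩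
  set p := β c with hp
  intro K hK hKc hKA
  have hρ2 : ((ρ / 2 : ℝ) : ℂ) ≠ 0 := by exact_mod_cast (by positivity : ρ / 2 ≠ 0)
  let D : ℂ ≃ₜ ℂ := (Homeomorph.mulLeft₀ ((ρ / 2 : ℝ) : ℂ) hρ2).trans (Homeomorph.addRight p)
  have hD : ∀ z, D z = (ρ / 2 : ℝ) * z + p := fun z => rfl
  have hDs : ∀ z, D.symm z = (z - p) / (ρ / 2 : ℝ) := fun z => by
    rw [Homeomorph.symm_apply_eq, hD]; field_simp; ring
  have hDn : ∀ z, ‖D.symm z‖ = ‖z - p‖ / (ρ / 2) := fun z => by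
    rw [hDs, norm_div, Complex.norm_real, Real.norm_of_nonneg (by positivity)]
  let Θ : ℂ → T := ψ ∘ D
  have hΘ : IsOpenEmbedding Θ := hψ.comp D.isOpenEmbedding
  have hΘβ : ∀ t ∈ Set.Icc a w, Θ (D.symm (β t)) = α t := fun t ht => by
    simp only [Θ, Function.comp, D.apply_symm_apply, hβ t ht]
  have hΘball : ∀ z ∈ Metric.ball (0 : ℂ) 1, Θ z ∉ B ∪ α '' Set.Icc w 1 := by
    intro z hz
    refine hρfar ?_
    rw [mem_ball_zero_iff] at hz
    rw [Metric.mem_ball, dist_eq_norm, hD]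
    calc ‖((ρ / 2 : ℝ) : ℂ) * z + p - p₀‖ ≤ ‖((ρ / 2 : ℝ) : ℂ) * z‖ + ‖p - p₀‖ := by
          rw [add_sub_assoc]; exact norm_add_le _ _
      _ = ρ / 2 * ‖z‖ + ‖p - p₀‖ := by
          rw [norm_mul, Complex.norm_real, Real.norm_of_nonneg (by positivity)]
      _ < ρ := by nlinarith
  have hcA : α c ∉ K := fun h =>
    Set.disjoint_left.1 hKA h (Or.inr ⟨c, ⟨le_rfl, hcw.le.trans hw.2.le⟩, rfl⟩)
  have hΘ0 : Θ 0 = α c := by simp [Θ, hD, hp, hβ c hcm]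
  obtain ⟨r, hr, hrK⟩ : ∃ r > 0, ∀ z : ℂ, ‖z‖ < r → Θ z ∉ K := by
    obtain ⟨r, hr, h⟩ := Metric.mem_nhds_iff.1
      ((hK.isClosed.isOpen_compl.preimage hΘ.continuous).mem_nhds (x := 0) (by
        rw [Set.mem_preimage, hΘ0]; exact hcA))
    exact ⟨r, hr, fun z hz => h (mem_ball_zero_iff.2 hz)⟩
  have hfm : ∀ s ∈ Set.Icc (0 : ℝ) 1, c + s * (w - c) ∈ Set.Icc c w := fun s hs =>
    ⟨by nlinarith [hs.1], by nlinarith [hs.2]⟩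
  have hlm : ∀ s ∈ Set.Icc (0 : ℝ) 1, a + s * (c - a) ∈ Set.Icc a c := fun s hs =>
    ⟨by nlinarith [hs.1, hc.1], by nlinarith [hs.2, hc.1]⟩
  have hcwa : Set.Icc c w ⊆ Set.Icc a w := Set.Icc_subset_Icc_left hc.1.le
  have haca : Set.Icc a c ⊆ Set.Icc a w := Set.Icc_subset_Icc_right hcw.le
  let f : ℝ → ℂ := fun s => D.symm (β (c + s * (w - c)))
  let l : ℝ → ℂ := fun s => D.symm (β (a + s * (c - a)))
  have hDp : D.symm p = 0 := by rw [hDs]; simp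
  obtain ⟨h, hh, hhl⟩ := exists_shrink_arc (f := f) (l := l)
    (D.symm.continuous.comp_continuousOn ((hβc.mono hcwa).comp (by fun_prop) hfm))
    (by simp only [f, zero_mul, add_zero]; exact hDp)
    (fun t ht h0 => by
      have h1 : β (c + t * (w - c)) = β c := D.symm.injective (h0.trans hDp.symm)
      have h2 := hβinj (hcwa (hfm t ⟨ht.1.le, ht.2⟩)) hcm h1
      have := mul_pos ht.1 (sub_pos.2 hcw)
      linarith)
    (by
      have h1 : f 1 = D.symm (β w) := by simp [f]
      rw [h1, hDn, le_div_iff₀ (by positivity), one_mul]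
      have h2 : ρ ≤ ‖β w - p₀‖ := by
        by_contra hcon
        have hmem : β w ∈ Metric.ball p₀ ρ := by
          rw [Metric.mem_ball, dist_eq_norm]; exact not_le.1 hcon
        have h3 := hρfar hmem
        rw [Set.mem_preimage, hβ w ⟨hw.1.le, le_rfl⟩] at h3
        exact h3 (Or.inr ⟨w, ⟨le_rfl, hw.2.le⟩, rfl⟩)
      have h3 : ‖β w - p₀‖ ≤ ‖β w - p‖ + ‖p - p₀‖ := norm_sub_le_norm_sub_add_norm_sub _ _ _
      linarith)
    (D.symm.continuous.comp_continuousOn ((hβc.mono haca).comp (by fun_prop) hlm))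
    (by simp only [l, one_mul, add_sub_cancel]; exact hDp)
    (fun t ht => by
      have h1 := hβρ _ (hlm t ht)
      have h3 : ‖β (a + t * (c - a)) - p‖ ≤ ‖β (a + t * (c - a)) - p₀‖ + ‖p₀ - p‖ :=
        norm_sub_le_norm_sub_add_norm_sub _ _ _
      rw [norm_sub_rev p₀ p] at h3
      change ‖D.symm _‖ < 1
      rw [hDn, div_lt_one (by positivity)]
      linarith)
    (by
      rintro t ht ⟨s, hs, hst⟩
      have h1 := hβinj (hcwa (hfm s hs)) (haca (hlm t ⟨ht.1, ht.2.le⟩)) (D.symm.injective hst)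
      have h2 := (hfm s hs).1
      nlinarith [ht.2, hc.1])
    hr
  obtain ⟨H, hH, hHΘ⟩ := hh.extend hΘ
  have hHA : ∀ x ∈ B ∪ α '' Set.Icc c 1, H x = x := by
    intro x hx
    refine hH.apply_eq ?_
    rintro ⟨z, ⟨hz1, hz2⟩, rfl⟩
    have h1 := hΘball z hz1
    rcases hx with hx | ⟨t, ht, htz⟩
    · exact h1 (Or.inl hx)
    rcases le_total w t with hwt | hwt
    · exact h1 (Or.inr ⟨t, ⟨hwt, ht.2⟩, htz⟩)
    · have hcw' : 0 < w - c := sub_pos.2 hcw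
      rw [← hΘβ t ⟨hc.1.le.trans ht.1, hwt⟩] at htz
      refine hz2 ⟨(t - c) / (w - c), ⟨div_nonneg (sub_nonneg.2 ht.1) hcw'.le,
        (div_le_one hcw').2 (by linarith)⟩, ?_⟩
      have : c + (t - c) / (w - c) * (w - c) = t := by field_simp; ring
      simp only [f, this]
      exact hΘ.injective htz
  obtain ⟨χ, hχ, hKχ, hχA⟩ := hcov (H.symm '' K) (hK.image H.symm.continuous)
    (hKc.image _ H.symm.continuous.continuousOn) (by
      rw [Set.disjoint_left]
      rintro _ ⟨x, hx, rfl⟩ hxA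
      have hbad : ∀ u ∈ B ∪ α '' Set.Icc c 1, H.symm x ≠ u := by
        intro u hu hxu
        have h1 : x = H u := by rw [← hxu, H.apply_symm_apply]
        rw [hHA u hu] at h1
        exact Set.disjoint_left.1 hKA (h1 ▸ hx) hu
      rcases hxA with hxA | ⟨t, ht, htx⟩
      · exact hbad _ (Or.inl hxA) rfl
      rcases le_or_gt c t with hct | hct
      · exact hbad _ (Or.inr ⟨t, ⟨hct, ht.2⟩, htx⟩) rfl
      have hca : 0 < c - a := sub_pos.2 hc.1
      have h1 := hhl ((t - a) / (c - a)) ⟨div_nonneg (sub_nonneg.2 ht.1) hca.le,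
        (div_lt_one hca).2 (by linarith)⟩
      have h2 : a + (t - a) / (c - a) * (c - a) = t := by field_simp; ring
      simp only [l, h2] at h1
      refine hrK _ h1 ?_
      rw [← hHΘ, hΘβ t ⟨ht.1, hct.le.trans hcw.le⟩, htx, H.apply_symm_apply]
      exact hx)
  refine ⟨H ∘ χ, H.isOpenEmbedding.comp hχ, ?_, ?_⟩
  · intro x hx
    obtain ⟨z, hz⟩ := hKχ ⟨x, hx, rfl⟩
    exact ⟨z, by simp [hz]⟩
  · rw [Set.disjoint_left]
    rintro _ ⟨z, rfl⟩ hzA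
    have h1 : H (χ z) = χ z := H.injective (hHA _ hzA)
    simp only [Function.comp, h1] at hzA
    refine Set.disjoint_left.1 hχA ⟨z, rfl⟩ (hzA.imp_right fun h => ?_)
    exact Set.image_mono (Set.Icc_subset_Icc_left hc.1.le) h

theorem DiscCovered.of_union_arc
    (hch : ∀ x : T, ∃ ψ : ℂ → T, IsOpenEmbedding ψ ∧ x ∈ Set.range ψ) {B : Set T}
    (hB : IsClosed B) {α : ℝ → T} (hα : ContinuousOn α (Set.Icc 0 1))
    (hinj : Set.InjOn α (Set.Icc 0 1)) (hαB : ∀ t ∈ Set.Ico (0 : ℝ) 1, α t ∉ B) (hα1 : α 1 ∈ B)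
    (hcov : DiscCovered (B ∪ α '' Set.Icc 0 1)) : DiscCovered B := by
  let S : Set ℝ := {t | ∀ s ∈ Set.Icc 0 t, DiscCovered (B ∪ α '' Set.Icc s 1)}
  have hS : Set.Icc (0 : ℝ) 1 ⊆ S := by
    refine IsClosed.Icc_subset_of_forall_exists_gt ?_ ?_ ?_
    · refine isClosed_of_closure_subset fun t ht => ?_
      have htI : t ∈ Set.Icc (0 : ℝ) 1 := by
        have := closure_mono Set.inter_subset_right ht
        rwa [isClosed_Icc.closure_eq] at this
      refine ⟨fun s hs => ?_, htI⟩
      by_cases hlt : ∃ u ∈ S, s ≤ u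
      · obtain ⟨u, hu, hsu⟩ := hlt
        exact hu s ⟨hs.1, hsu⟩
      push Not at hlt
      intro K hK hKc hKA
      have hsI : s ∈ Set.Icc (0 : ℝ) 1 := ⟨hs.1, hs.2.trans htI.2⟩
      have hαs : α s ∈ Kᶜ := fun h =>
        Set.disjoint_left.1 hKA h (Or.inr ⟨s, ⟨le_rfl, hsI.2⟩, rfl⟩)
      have hnear : ∀ᶠ u in 𝓝[Set.Icc 0 1] s, α u ∉ K :=
        (hα s hsI).eventually (hK.isClosed.isOpen_compl.mem_nhds hαs)
      obtain ⟨ε, hε, hεK⟩ := Metric.mem_nhdsWithin_iff.1 hnear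
      obtain ⟨u, ⟨huS, huI⟩, hut⟩ := Metric.mem_closure_iff.1 ht ε hε
      have hus := hlt u huS
      rw [Real.dist_eq, abs_lt] at hut
      obtain ⟨χ, hχ, hKχ, hχA⟩ := huS u ⟨huI.1, le_rfl⟩ K hK hKc (by
        rw [Set.disjoint_left] at hKA ⊢
        rintro x hx (hxB | ⟨v, hv, rfl⟩)
        · exact hKA hx (Or.inl hxB)
        rcases le_or_gt s v with hsv | hvs
        · exact hKA hx (Or.inr ⟨v, ⟨hsv, hv.2⟩, rfl⟩)
        · refine hεK ⟨?_, huI.1.trans hv.1, hv.2⟩ hx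
          rw [Metric.mem_ball, Real.dist_eq, abs_lt]
          constructor <;> linarith [hv.1, hs.2])
      exact ⟨χ, hχ, hKχ, hχA.mono_right
        (Set.union_subset_union_right _ (Set.image_mono (Set.Icc_subset_Icc_left hus.le)))⟩
    · rintro s ⟨h1, h2⟩
      rwa [le_antisymm h2 h1]
    · rintro x ⟨hx, hxI⟩ y hy
      obtain ⟨c₀, hc₀, hcov₀⟩ := DiscCovered.eventually_union_arc hch hB hα hinj hαB hxI
        (hx x ⟨hxI.1, le_rfl⟩)
      refine ⟨min c₀ y, fun s hs => ?_, lt_min hc₀.1 hy, min_le_right _ _⟩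
      rcases le_or_gt s x with hsx | hsx
      · exact hx s ⟨hs.1, hsx⟩
      · exact hcov₀ s ⟨hsx, hs.2.trans (min_le_left _ _)⟩
  have := hS (Set.right_mem_Icc.2 zero_le_one) 1 ⟨zero_le_one, le_rfl⟩
  rwa [Set.Icc_self, Set.image_singleton, Set.union_eq_self_of_subset_right
    (Set.singleton_subset_iff.2 hα1)] at this

end ArcRemoval

section Components

variable {T : Type*} [TopologicalSpace T]

/-- Charts modelled on the complex plane make a space a charted space. -/
@[reducible] def chartedSpaceOfOpenEmbeddings
    (hch : ∀ x : T, ∃ ψ : ℂ → T, IsOpenEmbedding ψ ∧ x ∈ Set.range ψ) : ChartedSpace ℂ T where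
  atlas := Set.univ
  chartAt x := ((hch x).choose_spec.1.toOpenPartialHomeomorph _).symm
  mem_chart_source x := by
    simpa using (hch x).choose_spec.2
  chart_mem_atlas _ := Set.mem_univ _

theorem exists_compact_connected_superset [T2Space T] [LocallyPathConnectedSpace T] [LocallyCompactSpace T]
    {U : Set T} (hU : IsOpen U) (hUc : IsConnected U) {K : Set T} (hK : IsCompact K)
    (hKU : K ⊆ U) : ∃ C, IsCompact C ∧ IsConnected C ∧ K ⊆ C ∧ C ⊆ U := by
  have hUp : IsPathConnected U := hU.isConnected_iff_isPathConnected.1 hUc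
  obtain ⟨u₀, hu₀⟩ := hUc.nonempty
  have key : ∀ x ∈ K, ∃ C, IsCompact C ∧ IsConnected C ∧ C ∈ 𝓝 x ∧ C ⊆ U ∧ u₀ ∈ C := by
    intro x hx
    obtain ⟨N, hN, hNU, hNc⟩ := local_compact_nhds (hU.mem_nhds (hKU hx))
    have hV : connectedComponentIn (interior N) x ∈ 𝓝 x :=
      connectedComponentIn_mem_nhds (interior_mem_nhds.2 hN)
    have hVN : closure (connectedComponentIn (interior N) x) ⊆ N :=
      closure_minimal ((connectedComponentIn_subset _ _).trans interior_subset) hNc.isClosed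
    obtain ⟨γ, hγ⟩ := hUp.joinedIn u₀ hu₀ x (hKU hx)
    have hγc : IsConnected (Set.range γ) := isConnected_range γ.continuous
    refine ⟨Set.range γ ∪ closure (connectedComponentIn (interior N) x),
      (isCompact_range γ.continuous).union (hNc.of_isClosed_subset isClosed_closure hVN),
      hγc.union ⟨x, ⟨1, γ.target⟩, subset_closure (mem_of_mem_nhds hV)⟩
        ⟨⟨x, subset_closure (mem_of_mem_nhds hV)⟩, isPreconnected_connectedComponentIn.closure⟩,
      mem_of_superset hV (subset_closure.trans Set.subset_union_right),
      Set.union_subset (Set.range_subset_iff.2 hγ) (hVN.trans hNU), Or.inl ⟨0, γ.source⟩⟩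
  choose! C hC1 hC2 hC3 hC4 hC5 using key
  obtain ⟨t, ht, htK⟩ := hK.elim_nhds_subcover C hC3
  refine ⟨{u₀} ∪ ⋃ x ∈ t, C x, isCompact_singleton.union (t.isCompact_biUnion fun x hx => hC1 x (ht x hx)), ?_, ?_, ?_⟩
  · refine ⟨⟨u₀, Or.inl rfl⟩, ?_⟩
    have : {u₀} ∪ ⋃ x ∈ t, C x = ⋃₀ insert {u₀} (C '' t) := by simp
    rw [this]
    refine isPreconnected_sUnion u₀ _ ?_ ?_
    · rintro s (rfl | ⟨x, hx, rfl⟩)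
      · rfl
      · exact hC5 x (ht x hx)
    · rintro s (rfl | ⟨x, hx, rfl⟩)
      · exact isPreconnected_singleton
      · exact (hC2 x (ht x hx)).isPreconnected
  · exact htK.trans Set.subset_union_right
  · exact Set.union_subset (Set.singleton_subset_iff.2 hu₀) (Set.iUnion₂_subset fun x hx => hC4 x (ht x hx))

theorem DiscCovered.nonempty_homeomorph [T2Space T] [LocallyPathConnectedSpace T]
    [LocallyCompactSpace T] [SecondCountableTopology T] {A : Set T} (hA : IsClosed A)
    (hcov : DiscCovered A) {x : T} (hx : x ∉ A) :
    Nonempty (ℂ ≃ₜ connectedComponentIn Aᶜ x) := by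
  set U := connectedComponentIn Aᶜ x with hUdef
  have hU : IsOpen U := hA.isOpen_compl.connectedComponentIn
  have hUc : IsConnected U := isConnected_connectedComponentIn_iff.2 hx
  have hUA : U ⊆ Aᶜ := connectedComponentIn_subset _ _
  have : LocallyCompactSpace U := hU.locallyCompactSpace
  refine nonempty_homeomorph_complex (CompactExhaustion.choice U) fun K hK => ?_
  obtain ⟨C, hC1, hC2, hC3, hC4⟩ := exists_compact_connected_superset hU hUc
    (hK.image continuous_subtype_val) (by rintro _ ⟨y, -, rfl⟩; exact y.2)
  obtain ⟨χ, hχ, hCχ, hχA⟩ := hcov C hC1 hC2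
    (Set.disjoint_left.2 fun y hy hyA => hUA (hC4 hy) hyA)
  have hχU : ∀ z, χ z ∈ U := by
    obtain ⟨y, hy⟩ := hC2.nonempty
    have h1 : Set.range χ ⊆ connectedComponentIn Aᶜ y :=
      (isPreconnected_range hχ.continuous).subset_connectedComponentIn (hCχ hy)
        hχA.subset_compl_right
    rw [← connectedComponentIn_eq (hC4 hy), ← hUdef] at h1
    exact fun z => h1 ⟨z, rfl⟩
  refine ⟨Set.codRestrict χ U hχU, ?_, ?_⟩
  · refine IsOpenEmbedding.of_comp (Y := U) _ hU.isOpenEmbedding_subtypeVal hχ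
  · intro y hy
    obtain ⟨z, hz⟩ := hCχ (hC3 ⟨y, hy, rfl⟩)
    exact ⟨z, Subtype.ext hz⟩

end Components

theorem isTwoCell_iff {X : Type} [TopologicalSpace X] {A : Set X} :
    IsTwoCell A ↔ Nonempty (ℂ ≃ₜ A) := by
  let e : ℂ ≃ₜ Metric.ball (0 : Plane) 1 :=
    Complex.orthonormalBasisOneI.repr.toHomeomorph.trans Homeomorph.unitBall
  exact ⟨fun ⟨f⟩ => ⟨e.trans f.symm⟩, fun ⟨f⟩ => ⟨f.symm.trans e⟩⟩

theorem IsClosedSurface.exists_chart {X : Type} [TopologicalSpace X] (hX : IsClosedSurface X)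
    (x : X) : ∃ ψ : ℂ → X, IsOpenEmbedding ψ ∧ x ∈ Set.range ψ := by
  obtain ⟨U, hU, hxU, hcell⟩ := hX.2.2.2 x
  obtain ⟨e⟩ := isTwoCell_iff.1 hcell
  exact ⟨_, hU.isOpenEmbedding_subtypeVal.comp e.isOpenEmbedding, e.symm ⟨x, hxU⟩, by simp⟩

theorem IsClosedSurface.isTwoCell_iff_discCovered {X : Type} [TopologicalSpace X]
    (hX : IsClosedSurface X) {A : Set X} (hA : IsClosed A) :
    (∀ x ∈ Set.univ \ A, IsTwoCell (connectedComponentIn (Set.univ \ A) x)) ↔ DiscCovered A := by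
  obtain ⟨_, _, _, -⟩ := id hX
  let := chartedSpaceOfOpenEmbeddings hX.exists_chart
  have := ChartedSpace.locallyPathConnectedSpace ℂ X
  have := ChartedSpace.secondCountable_of_sigmaCompact ℂ X
  rw [← Set.compl_eq_univ_sdiff]
  constructor
  · intro h K hK hKc hKA
    obtain ⟨y, hy⟩ := hKc.nonempty
    obtain ⟨e⟩ := isTwoCell_iff.1 (h y (Set.disjoint_left.1 hKA hy))
    refine ⟨_, hA.isOpen_compl.connectedComponentIn.isOpenEmbedding_subtypeVal.comp
      e.isOpenEmbedding, ?_, ?_⟩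
    · rw [e.surjective.range_comp, Subtype.range_val]
      exact hKc.isPreconnected.subset_connectedComponentIn hy hKA.subset_compl_right
    · rw [e.surjective.range_comp, Subtype.range_val]
      exact Set.disjoint_left.2 fun z hz => connectedComponentIn_subset _ _ hz
  · intro h x hx
    exact isTwoCell_iff.2 (h.nonempty_homeomorph hA hx)

namespace Multigraph

variable (M : Multigraph)

theorem compactSpace_pre : CompactSpace M.Pre := by
  let : TopologicalSpace M.V := ⊥
  let : TopologicalSpace M.E := ⊥
  have := M.vFin
  have := M.eFin
  exact inferInstanceAs (CompactSpace (M.V ⊕ (M.E × unitInterval)))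

instance compactSpace_real : CompactSpace M.Real :=
  @Quot.compactSpace _ _ M.glue M.compactSpace_pre

theorem continuous_edgePath (e : M.E) : Continuous (M.edgePath e) := by
  let : TopologicalSpace M.V := ⊥
  let : TopologicalSpace M.E := ⊥
  have h : Continuous fun t : unitInterval => (Sum.inr (e, t) : M.V ⊕ (M.E × unitInterval)) := by
    fun_prop
  exact (continuous_quot_mk (r := M.glue)).comp h

theorem edgePath_zero (e : M.E) : M.edgePath e 0 = M.vtx (M.ends e false) :=
  Quot.sound ⟨e, false, rfl, rfl⟩

theorem edgePath_one (e : M.E) : M.edgePath e 1 = M.vtx (M.ends e true) :=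
  Quot.sound ⟨e, true, rfl, rfl⟩

theorem eq_vtx_or_edgePath (x : M.Real) : (∃ v, x = M.vtx v) ∨ ∃ e t, x = M.edgePath e t := by
  obtain ⟨v | ⟨e, t⟩, rfl⟩ := Quot.exists_rep x
  exacts [Or.inl ⟨v, rfl⟩, Or.inr ⟨e, t, rfl⟩]

end Multigraph

namespace HEG

variable (G : HEG)

theorem inclReal_vtx (v : G.V) :
    G.inclReal (G.underlyingMG.vtx v) = G.completedMG.vtx (Sum.inl v) := rfl

theorem inclReal_edgePath (e : G.E) (t : unitInterval) :
    G.inclReal (G.underlyingMG.edgePath e t) = G.completedMG.edgePath (Sum.inl e) t := rfl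

theorem continuous_inclReal : Continuous G.inclReal := by
  let : TopologicalSpace G.V := ⊥
  let : TopologicalSpace G.E := ⊥
  let : TopologicalSpace (G.V ⊕ G.Hh) := ⊥
  let : TopologicalSpace (G.E ⊕ G.Hh) := ⊥
  have : DiscreteTopology G.V := ⟨rfl⟩
  have : DiscreteTopology G.E := ⟨rfl⟩
  have h : Continuous (Sum.map Sum.inl (fun p => (Sum.inl p.1, p.2)) :
      G.V ⊕ (G.E × unitInterval) → (G.V ⊕ G.Hh) ⊕ ((G.E ⊕ G.Hh) × unitInterval)) :=
    continuous_of_discreteTopology.sumMap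
      ((continuous_of_discreteTopology.comp continuous_fst).prodMk continuous_snd)
  exact continuous_quot_lift _ ((continuous_quot_mk (r := G.completedMG.glue)).comp h)

/-- Collapse every half-edge of the completed graph to the vertex it is incident to. -/
def retract : G.completedMG.Real → G.underlyingMG.Real :=
  Quot.lift (fun x => match x with
    | .inl (.inl v) => G.underlyingMG.vtx v
    | .inl (.inr h) => G.underlyingMG.vtx (G.hInc h)
    | .inr (.inl e, t) => G.underlyingMG.edgePath e t
    | .inr (.inr h, _) => G.underlyingMG.vtx (G.hInc h)) (by
      rintro _ _ ⟨e | h, b, rfl, rfl⟩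
      · exact Quot.sound ⟨e, b, rfl, rfl⟩
      · cases b <;> rfl)

theorem inclReal_injective : Function.Injective G.inclReal := by
  refine Function.LeftInverse.injective (g := G.retract) fun x => ?_
  obtain ⟨v, rfl⟩ | ⟨e, t, rfl⟩ := G.underlyingMG.eq_vtx_or_edgePath x <;> rfl

/-- The position along the half-edge `h`, extended by `0` to the rest of the completed graph. -/
def height (h : G.Hh) : G.completedMG.Real → ℝ :=
  Quot.lift (fun x => match x with
    | .inl (.inl _) => 0
    | .inl (.inr k) => if k = h then 1 else 0
    | .inr (.inl _, _) => 0
    | .inr (.inr k, t) => if k = h then t else 0) (by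
      rintro _ _ ⟨e | k, b, rfl, rfl⟩
      · rfl
      · cases b <;> simp [completedMG])

theorem height_inclReal (h : G.Hh) (x : G.underlyingMG.Real) : G.height h (G.inclReal x) = 0 := by
  obtain ⟨v, rfl⟩ | ⟨e, t, rfl⟩ := G.underlyingMG.eq_vtx_or_edgePath x <;> rfl

theorem height_edgePath (h k : G.Hh) (t : unitInterval) :
    G.height h (G.completedMG.edgePath (Sum.inr k) t) = if k = h then (t : ℝ) else 0 := rfl

/-- The half-edge `h`, traversed from its new end vertex. -/
def halfEdgePath (h : G.Hh) (t : ℝ) : G.completedMG.Real :=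
  G.completedMG.edgePath (Sum.inr h) (unitInterval.symm (Set.projIcc 0 1 zero_le_one t))

theorem continuous_halfEdgePath (h : G.Hh) : Continuous (G.halfEdgePath h) :=
  (G.completedMG.continuous_edgePath _).comp (unitInterval.continuous_symm.comp continuous_projIcc)

theorem height_halfEdgePath {h : G.Hh} {t : ℝ} (ht : t ∈ Set.Icc (0 : ℝ) 1) :
    G.height h (G.halfEdgePath h t) = 1 - t := by
  rw [halfEdgePath, height_edgePath, if_pos rfl, Set.projIcc_of_mem _ ht]
  rfl

theorem height_halfEdgePath_of_ne {h k : G.Hh} (hk : k ≠ h) (t : ℝ) :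
    G.height h (G.halfEdgePath k t) = 0 := by
  rw [halfEdgePath, height_edgePath, if_neg hk]

theorem halfEdgePath_one (h : G.Hh) :
    G.halfEdgePath h 1 = G.inclReal (G.underlyingMG.vtx (G.hInc h)) := by
  rw [halfEdgePath, Set.projIcc_right, inclReal_vtx]
  change G.completedMG.edgePath (Sum.inr h) (unitInterval.symm 1) = _
  rw [unitInterval.symm_one]
  exact G.completedMG.edgePath_zero (Sum.inr h)

theorem range_inclReal_union :
    Set.range G.inclReal ∪ ⋃ h, G.halfEdgePath h '' Set.Icc 0 1 = Set.univ := by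
  have key : ∀ (h : G.Hh) (t : unitInterval), G.completedMG.edgePath (Sum.inr h) t ∈
      Set.range G.inclReal ∪ ⋃ h, G.halfEdgePath h '' Set.Icc 0 1 := by
    intro h t
    refine Or.inr (Set.mem_iUnion.2 ⟨h, unitInterval.symm t, (unitInterval.symm t).2, ?_⟩)
    rw [halfEdgePath, Set.projIcc_val, unitInterval.symm_symm]
  refine Set.eq_univ_of_forall fun x => ?_
  obtain ⟨v | h, rfl⟩ | ⟨e | h, t, rfl⟩ := G.completedMG.eq_vtx_or_edgePath x
  · exact Or.inl ⟨_, G.inclReal_vtx v⟩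
  · exact G.completedMG.edgePath_one (Sum.inr h) ▸ key h 1
  · exact Or.inl ⟨_, G.inclReal_edgePath e t⟩
  · exact key h t

end HEG

end CellRemoval

/-- Let `G` be a HEG with completed graph `𝒢̄` and underlying
graph `𝒢`.  If `φ` is a regular embedding of `𝒢̄` in a punctured surface `Σ`
(with boundary `∂Σ`), then the restriction of `φ` to `𝒢` is a cellular
embedding of `𝒢` in the capped-off closed surface `Σ̃`: it is an embedding and
`Σ̃ − φ(𝒢)` is a disjoint union of 2-cells. -/
theorem regular_embedding_restricts_to_cellular (G : HEG) (S : PuncturedSurface)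
    (φ : RegularEmbedding G S) :
    Topology.IsEmbedding (φ.toFun ∘ G.inclReal) ∧
    ∀ x ∈ Set.univ \ Set.range (φ.toFun ∘ G.inclReal),
      IsTwoCell
        (connectedComponentIn (Set.univ \ Set.range (φ.toFun ∘ G.inclReal)) x) := by
  have hT2 : T2Space S.Total := S.surf.2.2.1
  have hcont : Continuous (φ.toFun ∘ G.inclReal) := φ.emb.continuous.comp G.continuous_inclReal
  have hemb : Topology.IsClosedEmbedding (φ.toFun ∘ G.inclReal) :=
    hcont.isClosedEmbedding (φ.emb.injective.comp G.inclReal_injective)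
  refine ⟨hemb.isEmbedding, (S.surf.isTwoCell_iff_discCovered hemb.isClosed_range).2 ?_⟩
  let α : G.Hh → ℝ → S.Total := fun h => φ.toFun ∘ G.halfEdgePath h
  have hα : ∀ h, Continuous (α h) := fun h => φ.emb.continuous.comp (G.continuous_halfEdgePath h)
  let B : Finset G.Hh → Set S.Total := fun s =>
    Set.range (φ.toFun ∘ G.inclReal) ∪ ⋃ h ∈ s, α h '' Set.Icc 0 1
  have hBc : ∀ s, IsClosed (B s) := fun s => hemb.isClosed_range.union
    (s.isCompact_biUnion fun h _ => isCompact_Icc.image (hα h)).isClosed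
  have hstep : ∀ s : Finset G.Hh, DiscCovered (B s) → DiscCovered (B ∅) := by
    intro s
    induction s using Finset.induction_on with
    | empty => exact id
    | insert h s hs ih =>
      refine fun hcov => ih (DiscCovered.of_union_arc S.surf.exists_chart (hBc s)
        (hα h).continuousOn ?_ ?_ ?_ (α := α h) ?_)
      · intro t ht u hu htu
        have h1 := congrArg (G.height h) (φ.emb.injective htu)
        rw [G.height_halfEdgePath ht, G.height_halfEdgePath hu] at h1
        linarith
      · intro t ht htB
        have h0 : G.height h (G.halfEdgePath h t) = 0 := by
          rcases htB with ⟨x, hx⟩ | htB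
          · rw [← φ.emb.injective hx, G.height_inclReal]
          · obtain ⟨k, hk, u, -, hu⟩ := Set.mem_iUnion₂.1 htB
            rw [← φ.emb.injective hu, G.height_halfEdgePath_of_ne]
            rintro rfl
            exact hs hk
        rw [G.height_halfEdgePath ⟨ht.1, ht.2.le⟩] at h0
        linarith [ht.2]
      · exact Or.inl ⟨_, congrArg φ.toFun (G.halfEdgePath_one h).symm⟩
      · convert hcov using 1
        simp only [B, Finset.set_biUnion_insert]
        rw [Set.union_assoc, Set.union_comm (α h '' _)]
  have := G.hFin
  let := Fintype.ofFinite G.Hh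
  have hB : B Finset.univ = Set.range φ.toFun := by
    have h1 := congrArg (Set.image φ.toFun) G.range_inclReal_union
    rw [Set.image_univ, Set.image_union, Set.image_iUnion, ← Set.range_comp] at h1
    rw [← h1]
    simp only [B, α, Finset.mem_univ, Set.iUnion_true, Set.image_comp]
  have hfin := hstep Finset.univ (hB ▸ (S.surf.isTwoCell_iff_discCovered
    (hB ▸ hBc Finset.univ)).1 φ.cellular)
  simpa [B] using hfin
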